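/- arXiv:2012.04161 — 2 statements merged into one kernel-verified Lean document; each statement's English description precedes it below -/
import Mathlib

section
/- Let p, q ∈ (1,∞), r ∈ (p,∞), s ∈ (q,∞) with 1 < d/p + 2/q = d/r + 2/s + 1. Suppose u : [0,T] × ℝ^d → ℝ satisfies ∂_t u ∈ L^q([0,T]; L^p(ℝ^d)), u ∈ L^q([0,T]; H^{2,p}(ℝ^d)), and u(0,·) = 0. Then ∇u ∈ L^s([0,T]; L^r(ℝ^d)) and ‖∇u‖_{L^s L^r} ≤ C (‖∂_t u‖_{L^q L^p} + ‖∇² u‖_{L^q L^p}), where C depends only on d, p, q, r, s. -/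
open MeasureTheory

theorem lintegral_lintegral_rpow_le_of_ne_zero {X S : Type*} [MeasurableSpace X]
    [MeasurableSpace S] {μ : Measure X} {ν : Measure S} [SFinite μ] [SFinite ν] {r : ℝ}
    (hr : 1 < r) {f : X → S → ENNReal} (hf : Measurable (Function.uncurry f)) {b : S → ENNReal}
    (hb : Measurable b) (h : ∀ s, ∫⁻ x, f x s ^ r ∂μ ≤ b s ^ r) (hb0 : ∀ s, b s ≠ 0)
    (hbt : ∫⁻ s, b s ∂ν ≠ ⊤) :
    ∫⁻ x, (∫⁻ s, f x s ∂ν) ^ r ∂μ ≤ (∫⁻ s, b s ∂ν) ^ r := by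
  have hr0 : 0 < r := by linarith
  have hc : r.HolderConjugate (r / (r - 1)) := Real.HolderConjugate.conjExponent hr
  set r' := r / (r - 1) with hr'
  have hr'0 : 0 < r' := hc.symm.pos
  have hrr' : r / r' = r - 1 := by
    rw [hr']; field_simp
  have hfin : ∀ᵐ s ∂ν, b s ≠ ⊤ := (ae_lt_top hb hbt).mono fun s hs => hs.ne
  have hfx : ∀ x, Measurable (f x) := fun x => hf.of_uncurry_left
  have key : ∀ x, (∫⁻ s, f x s ∂ν) ^ r ≤
      (∫⁻ s, f x s ^ r * b s ^ (1 - r) ∂ν) * (∫⁻ s, b s ∂ν) ^ (r - 1) := by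
    intro x
    have h1 : ∫⁻ s, f x s ∂ν = ∫⁻ s, ((fun s => f x s * b s ^ (-(1 / r'))) *
        (fun s => b s ^ (1 / r'))) s ∂ν := by
      refine lintegral_congr_ae (hfin.mono fun s hs => ?_)
      simp only [Pi.mul_apply]
      rw [mul_assoc, ← ENNReal.rpow_add _ _ (hb0 s) hs]
      simp
    have h2 := ENNReal.lintegral_mul_le_Lp_mul_Lq ν hc
      (f := fun s => f x s * b s ^ (-(1 / r'))) (g := fun s => b s ^ (1 / r'))
      ((hfx x).mul (hb.pow_const _)).aemeasurable (hb.pow_const _).aemeasurable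
    rw [← h1] at h2
    calc (∫⁻ s, f x s ∂ν) ^ r ≤ _ := ENNReal.rpow_le_rpow h2 hr0.le
      _ = _ := by
        rw [ENNReal.mul_rpow_of_nonneg _ _ hr0.le, ← ENNReal.rpow_mul, ← ENNReal.rpow_mul]
        congr 1
        · rw [one_div_mul_cancel hr0.ne', ENNReal.rpow_one]
          refine lintegral_congr fun s => ?_
          rw [ENNReal.mul_rpow_of_nonneg _ _ hr0.le, ← ENNReal.rpow_mul]
          congr 2
          rw [neg_mul, one_div_mul_eq_div, hrr']; ring
        · rw [one_div_mul_eq_div, hrr']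
          congr 1
          refine lintegral_congr fun s => ?_
          rw [← ENNReal.rpow_mul, one_div_mul_cancel hr'0.ne', ENNReal.rpow_one]
  calc ∫⁻ x, (∫⁻ s, f x s ∂ν) ^ r ∂μ
      ≤ ∫⁻ x, (∫⁻ s, f x s ^ r * b s ^ (1 - r) ∂ν) * (∫⁻ s, b s ∂ν) ^ (r - 1) ∂μ :=
        lintegral_mono key
    _ = (∫⁻ x, ∫⁻ s, f x s ^ r * b s ^ (1 - r) ∂ν ∂μ) * (∫⁻ s, b s ∂ν) ^ (r - 1) :=
        lintegral_mul_const' _ _ (ENNReal.rpow_ne_top_of_nonneg (by linarith) hbt)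
    _ ≤ (∫⁻ s, b s ∂ν) * (∫⁻ s, b s ∂ν) ^ (r - 1) := by
        gcongr
        have hm : Measurable (Function.uncurry fun x s => f x s ^ r * b s ^ (1 - r)) :=
          (hf.pow_const r).mul ((hb.comp measurable_snd).pow_const _)
        rw [lintegral_lintegral_swap hm.aemeasurable]
        refine lintegral_mono_ae (hfin.mono fun s hs => ?_)
        rw [lintegral_mul_const _ (hf.of_uncurry_right.pow_const r)]
        calc _ ≤ b s ^ r * b s ^ (1 - r) := by gcongr; exact h s
          _ = b s := by rw [← ENNReal.rpow_add _ _ (hb0 s) hs]; simp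
    _ = (∫⁻ s, b s ∂ν) ^ r := by
        conv_lhs => enter [1]; rw [← ENNReal.rpow_one (∫⁻ s, b s ∂ν)]
        rw [← ENNReal.rpow_add_of_nonneg _ _ zero_le_one (by linarith)]
        congr 1; ring

/-- **Minkowski's integral inequality**: the `Lʳ` norm of an integral is at most the integral of
a bound `b` for the `Lʳ` norms. -/
theorem lintegral_lintegral_rpow_le {X S : Type*} [MeasurableSpace X]
    [MeasurableSpace S] {μ : Measure X} {ν : Measure S} [SFinite μ] [SigmaFinite ν] {r : ℝ}
    (hr : 1 < r) {f : X → S → ENNReal} (hf : Measurable (Function.uncurry f)) {b : S → ENNReal}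
    (hb : Measurable b) (h : ∀ s, ∫⁻ x, f x s ^ r ∂μ ≤ b s ^ r) :
    ∫⁻ x, (∫⁻ s, f x s ∂ν) ^ r ∂μ ≤ (∫⁻ s, b s ∂ν) ^ r := by
  have hr0 : 0 < r := by linarith
  by_cases hbt : ∫⁻ s, b s ∂ν = ⊤
  · rw [hbt, ENNReal.top_rpow_of_pos hr0]; exact le_top
  rw [← ENNReal.rpow_inv_le_iff hr0]
  refine ENNReal.le_of_forall_pos_le_add fun ε hε _ => ?_
  obtain ⟨g, g0, gm, hg⟩ := exists_pos_lintegral_lt_of_sigmaFinite ν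
    (ε := (ε : ENNReal)) (by simpa using hε.ne')
  have hgm : Measurable fun s => (g s : ENNReal) := gm.coe_nnreal_ennreal
  rw [ENNReal.rpow_inv_le_iff hr0]
  have hadd : ∫⁻ s, (b s + g s) ∂ν = ∫⁻ s, b s ∂ν + ∫⁻ s, (g s : ENNReal) ∂ν :=
    lintegral_add_left hb _
  refine (lintegral_lintegral_rpow_le_of_ne_zero hr hf (b := fun s => b s + g s) (ν := ν)
    (hb.add hgm) (fun s => (h s).trans ?_) (fun s => ?_) ?_).trans ?_
  · gcongr; exact le_self_add
  · simp [(g0 s).ne']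
  · rw [hadd]; exact ENNReal.add_ne_top.2 ⟨hbt, hg.ne_top⟩
  · rw [hadd]; gcongr

/-- Integrating over the translates of a set of finite measure maps `Lᵖ` to `Lʳ`. -/
theorem lintegral_setLIntegral_sub_rpow_le {E : Type*} [NormedAddCommGroup E]
    [MeasurableSpace E] [BorelSpace E] [SecondCountableTopology E] (μ : Measure E) [SFinite μ]
    [μ.IsAddHaarMeasure] [μ.IsNegInvariant]
    {p r : ℝ} (hp : 1 < p) (hpr : p < r) {g : E → ENNReal} (hg : Measurable g) (B : Set E) :
    ∫⁻ x, (∫⁻ z in B, g (x - z) ∂μ) ^ r ∂μ ≤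
      (μ B ^ (1 - 1 / p + 1 / r) * (∫⁻ x, g x ^ p ∂μ) ^ (1 / p)) ^ r := by
  have hp0 : 0 < p := by linarith
  have hr0 : 0 < r := by linarith
  have hc : p.HolderConjugate (p / (p - 1)) := Real.HolderConjugate.conjExponent hp
  set p' := p / (p - 1) with hp'
  have hp'1 : 1 / p' = 1 - 1 / p := by rw [hp']; field_simp
  have hgx : ∀ x, Measurable fun z => g (x - z) := fun x =>
    hg.comp (measurable_const.sub measurable_id)
  set G := ∫⁻ x, g x ^ p ∂μ with hG
  set D : E → ENNReal := fun x => ∫⁻ z in B, g (x - z) ^ p ∂μ with hD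
  have hDG : ∀ x, D x ≤ G := fun x => by
    rw [hD, hG, ← lintegral_sub_left_eq_self (fun z => g z ^ p) x]
    exact setLIntegral_le_lintegral _ _
  have hm : Measurable (Function.uncurry fun x z => g (x - z) ^ p) :=
    (hg.comp (measurable_fst.sub measurable_snd)).pow_const p
  have hDm : Measurable D := hm.lintegral_prod_right'
  have hDI : ∫⁻ x, D x ∂μ = μ B * G := by
    rw [hD, lintegral_lintegral_swap hm.aemeasurable]
    have : ∀ z, ∫⁻ x, g (x - z) ^ p ∂μ = G := fun z =>
      lintegral_sub_right_eq_self (fun z => g z ^ p) z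
    simp [this, mul_comm]
  have hA : ∀ x, ∫⁻ z in B, g (x - z) ∂μ ≤ D x ^ (1 / p) * μ B ^ (1 - 1 / p) := fun x => by
    have := ENNReal.lintegral_mul_le_Lp_mul_Lq (μ.restrict B) hc
      (f := fun z => g (x - z)) (g := fun _ => 1) (hgx x).aemeasurable aemeasurable_const
    simpa only [Pi.mul_apply, mul_one, hp'1, ENNReal.one_rpow, lintegral_const,
      Measure.restrict_apply MeasurableSet.univ, Set.univ_inter, one_mul] using this
  have hq : 0 ≤ r / p - 1 := by rw [sub_nonneg, one_le_div hp0]; exact hpr.le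
  have hp1 : 0 ≤ 1 - 1 / p := by
    rw [sub_nonneg, div_le_one hp0]; exact hp.le
  calc ∫⁻ x, (∫⁻ z in B, g (x - z) ∂μ) ^ r ∂μ
      ≤ ∫⁻ x, D x * (G ^ (r / p - 1) * μ B ^ ((1 - 1 / p) * r)) ∂μ := by
        refine lintegral_mono fun x => (ENNReal.rpow_le_rpow (hA x) hr0.le).trans ?_
        rw [ENNReal.mul_rpow_of_nonneg _ _ hr0.le, ← ENNReal.rpow_mul, ← ENNReal.rpow_mul,
          ← mul_assoc]
        gcongr
        rw [show 1 / p * r = 1 + (r / p - 1) by ring,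
          ENNReal.rpow_add_of_nonneg _ _ zero_le_one hq, ENNReal.rpow_one]
        gcongr
        exact hDG x
    _ = μ B * G * (G ^ (r / p - 1) * μ B ^ ((1 - 1 / p) * r)) := by
        rw [lintegral_mul_const _ hDm, hDI]
    _ = _ := by
        rw [ENNReal.mul_rpow_of_nonneg _ _ hr0.le, ← ENNReal.rpow_mul, ← ENNReal.rpow_mul,
          show (1 - 1 / p + 1 / r) * r = 1 + (1 - 1 / p) * r by field_simp; ring,
          show 1 / p * r = 1 + (r / p - 1) by ring,
          ENNReal.rpow_add_of_nonneg _ _ zero_le_one hq,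
          ENNReal.rpow_add_of_nonneg _ _ zero_le_one (by positivity),
          ENNReal.rpow_one, ENNReal.rpow_one]
        ring

theorem lintegral_Ioc_rpow {a q : ℝ} (ha : 0 ≤ a) (hq : 0 < q) :
    ∫⁻ x in Set.Ioc 0 a, ENNReal.ofReal (x ^ (q - 1)) = ENNReal.ofReal (a ^ q / q) := by
  have hi := (intervalIntegral.intervalIntegrable_rpow' (a := 0) (b := a)
    (show -1 < q - 1 by linarith))
  rw [intervalIntegrable_iff_integrableOn_Ioc_of_le ha] at hi
  rw [← ofReal_integral_eq_lintegral_ofReal hi, ← intervalIntegral.integral_of_le ha,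
    integral_rpow (Or.inl (by linarith))]
  · simp [Real.zero_rpow hq.ne']
  · refine (ae_restrict_mem measurableSet_Ioc).mono fun x hx => ?_
    exact Real.rpow_nonneg hx.1.le _

theorem lintegral_Ioi_rpow_neg {a q : ℝ} (ha : 0 < a) (hq : 0 < q) :
    ∫⁻ x in Set.Ioi a, ENNReal.ofReal (x ^ (-q - 1)) = ENNReal.ofReal (a ^ (-q) / q) := by
  have h1 : -q - 1 < -1 := by linarith
  rw [← ofReal_integral_eq_lintegral_ofReal (integrableOn_Ioi_rpow_of_lt h1 ha),
    integral_Ioi_rpow_of_lt h1 ha]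
  · congr 1
    rw [sub_add_cancel, neg_div_neg_eq]
  · refine (ae_restrict_mem measurableSet_Ioi).mono fun x hx => ?_
    exact Real.rpow_nonneg (ha.trans hx).le _

/-- Layer-cake formula for the powers of an extended nonnegative number. -/
theorem lintegral_Ioi_indicator_rpow (x : ENNReal) {q : ℝ} (hq : 0 < q) :
    ∫⁻ l in Set.Ioi (0 : ℝ), {l : ℝ | ENNReal.ofReal l < x}.indicator
      (fun l => ENNReal.ofReal (l ^ (q - 1))) l = x ^ q / ENNReal.ofReal q := by
  have hms : MeasurableSet {l : ℝ | ENNReal.ofReal l < x} :=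
    measurableSet_lt ENNReal.measurable_ofReal measurable_const
  rw [lintegral_indicator hms, Measure.restrict_restrict hms]
  have hq' : ENNReal.ofReal q ≠ 0 := by simpa using hq
  induction x with
  | top =>
    rw [ENNReal.top_rpow_of_pos hq, ENNReal.top_div_of_ne_top ENNReal.ofReal_ne_top]
    refine ENNReal.eq_top_of_forall_nnreal_le fun r => ?_
    have h1 := lintegral_Ioc_rpow (a := (r * q.toNNReal : NNReal) ^ (1 / q)) (by positivity) hq
    rw [← Real.rpow_mul (by positivity), one_div_mul_cancel hq.ne', Real.rpow_one] at h1
    have h2 : ENNReal.ofReal (((r * q.toNNReal : NNReal) : ℝ) / q) = r := by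
      rw [NNReal.coe_mul, Real.coe_toNNReal _ hq.le, mul_div_cancel_right₀ _ hq.ne',
        ENNReal.ofReal_coe_nnreal]
    rw [← h2, ← h1]
    refine lintegral_mono_set fun y hy => ⟨?_, hy.1⟩
    simp
  | coe x =>
    have : {l : ℝ | ENNReal.ofReal l < x} ∩ Set.Ioi 0 = Set.Ioo 0 (x : ℝ) := by
      ext l
      simp only [Set.mem_inter_iff, Set.mem_ofPred_eq, Set.mem_Ioi, Set.mem_Ioo]
      constructor
      · rintro ⟨h, h0⟩
        refine ⟨h0, ?_⟩
        rwa [← ENNReal.ofReal_coe_nnreal, ENNReal.ofReal_lt_ofReal_iff_of_nonneg h0.le] at h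
      · rintro ⟨h0, h⟩
        refine ⟨?_, h0⟩
        rwa [← ENNReal.ofReal_coe_nnreal, ENNReal.ofReal_lt_ofReal_iff_of_nonneg h0.le]
    rw [this, restrict_Ioo_eq_restrict_Ioc, lintegral_Ioc_rpow x.coe_nonneg hq,
      ENNReal.ofReal_div_of_pos hq, ← ENNReal.ofReal_rpow_of_nonneg x.coe_nonneg hq.le,
      ENNReal.ofReal_coe_nnreal]

/-- The Hardy-Littlewood maximal function on the line, over dyadic radii. -/
noncomputable def dyadicMaximal (N : ℝ → ENNReal) (t : ℝ) : ENNReal :=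
  ⨆ k : ℤ, (∫⁻ z in Metric.closedBall 0 ((2 : ℝ) ^ k), N (t - z)) / ENNReal.ofReal ((2 : ℝ) ^ k)

theorem setLIntegral_closedBall_sub (N : ℝ → ENNReal) (t ρ : ℝ) :
    ∫⁻ z in Metric.closedBall 0 ρ, N (t - z) = ∫⁻ z in Metric.closedBall t ρ, N z := by
  rw [← lintegral_indicator Metric.isClosed_closedBall.measurableSet,
    ← lintegral_indicator Metric.isClosed_closedBall.measurableSet,
    ← lintegral_sub_left_eq_self (fun z => (Metric.closedBall t ρ).indicator N z) t]
  congr 1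
  ext z
  simp [Set.indicator, Real.norm_eq_abs]

theorem measurable_setLIntegral_sub {E : Type*} [NormedAddCommGroup E] [MeasurableSpace E]
    [BorelSpace E] [SecondCountableTopology E] (μ : Measure E) [SFinite μ] {N : E → ENNReal}
    (hN : Measurable N) (B : Set E) : Measurable fun t => ∫⁻ z in B, N (t - z) ∂μ :=
  (hN.comp (measurable_fst.sub measurable_snd)).lintegral_prod_right'

theorem measurable_dyadicMaximal {N : ℝ → ENNReal} (hN : Measurable N) :
    Measurable (dyadicMaximal N) :=
  Measurable.iSup fun _ => (measurable_setLIntegral_sub _ hN _).div_const _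

/-- The weak-type (1,1) inequality for the maximal function. -/
theorem mul_measure_lt_dyadicMaximal_le (N : ℝ → ENNReal) {l : ℝ} (hl : 0 < l) :
    ENNReal.ofReal l * volume {t | ENNReal.ofReal l < dyadicMaximal N t} ≤ 10 * ∫⁻ t, N t := by
  by_cases hN : ∫⁻ t, N t = ⊤
  · rw [hN]; simp
  set S := {t | ENNReal.ofReal l < dyadicMaximal N t}
  have hl' : ENNReal.ofReal l ≠ 0 := by simpa using hl
  have hk : ∀ t ∈ S, ∃ k : ℤ, ENNReal.ofReal l * ENNReal.ofReal ((2 : ℝ) ^ k) ≤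
      ∫⁻ z in Metric.closedBall t ((2 : ℝ) ^ k), N z := by
    intro t ht
    have ht' : ENNReal.ofReal l < dyadicMaximal N t := ht
    rw [dyadicMaximal] at ht'
    obtain ⟨k, hk⟩ := lt_iSup_iff.1 ht'
    refine ⟨k, ?_⟩
    rw [← setLIntegral_closedBall_sub]
    exact ENNReal.mul_le_of_le_div hk.le
  choose! k hk using hk
  have hR : ∀ t ∈ S, (2 : ℝ) ^ k t ≤ ((∫⁻ t, N t) / ENNReal.ofReal l).toReal := by
    intro t ht
    rw [← ENNReal.ofReal_le_iff_le_toReal (ENNReal.div_ne_top hN hl'),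
      ENNReal.le_div_iff_mul_le (Or.inl hl') (Or.inl ENNReal.ofReal_ne_top), mul_comm]
    exact (hk t ht).trans (setLIntegral_le_lintegral _ _)
  obtain ⟨u, huS, hud, hu⟩ := Vitali.exists_disjoint_subfamily_covering_enlargement_closedBall
    S id (fun t => (2 : ℝ) ^ k t) _ hR 5 (by norm_num)
  have hpos : ∀ t, (0 : ℝ) < 2 ^ k t := fun t => by positivity
  have huc : u.Countable := hud.countable_of_nonempty_interior fun t _ =>
    ⟨t, interior_mono Metric.ball_subset_closedBall
      (by rw [Metric.isOpen_ball.interior_eq]; exact Metric.mem_ball_self (hpos t))⟩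
  have hcov : S ⊆ ⋃ t ∈ u, Metric.closedBall t (5 * 2 ^ k t) := by
    intro t ht
    obtain ⟨b, hb, hsub⟩ := hu t ht
    exact Set.mem_biUnion hb (hsub (Metric.mem_closedBall_self (hpos t).le))
  calc ENNReal.ofReal l * volume S
      ≤ ENNReal.ofReal l * ∑' t : u, volume (Metric.closedBall (t : ℝ) (5 * 2 ^ k t)) := by
        gcongr
        exact (measure_mono hcov).trans (measure_biUnion_le _ huc _)
    _ = ∑' t : u, 10 * (ENNReal.ofReal l * ENNReal.ofReal ((2 : ℝ) ^ k t)) := by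
        rw [← ENNReal.tsum_mul_left]
        congr 1
        ext t
        rw [Real.volume_closedBall, ← mul_assoc, ENNReal.ofReal_mul (by norm_num)]
        norm_num
        ring
    _ ≤ ∑' t : u, 10 * ∫⁻ z in Metric.closedBall (t : ℝ) ((2 : ℝ) ^ k t), N z := by
        gcongr with t
        exact hk t (huS t.2)
    _ = 10 * ∫⁻ z in ⋃ t ∈ u, Metric.closedBall (t : ℝ) ((2 : ℝ) ^ k t), N z := by
        rw [ENNReal.tsum_mul_left]
        congr 1
        exact (lintegral_biUnion huc
          (fun t _ => Metric.isClosed_closedBall.measurableSet) hud N).symm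
    _ ≤ _ := by
        gcongr
        exact Measure.restrict_le_self

theorem mul_measure_lt_dyadicMaximal_le_truncated (N : ℝ → ENNReal) {l : ℝ} (hl : 0 < l) :
    ENNReal.ofReal l * volume {t | ENNReal.ofReal l < dyadicMaximal N t} ≤
      20 * ∫⁻ t, {t | ENNReal.ofReal l < 4 * N t}.indicator N t := by
  set N₁ := {t | ENNReal.ofReal l < 4 * N t}.indicator N with hN₁
  have hle : ∀ t, N t ≤ N₁ t + ENNReal.ofReal (l / 4) := by
    intro t
    by_cases h : ENNReal.ofReal l < 4 * N t
    · have : N₁ t = N t := Set.indicator_of_mem (s := {t | ENNReal.ofReal l < 4 * N t}) h N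
      rw [this]; exact le_self_add
    · refine le_trans ?_ le_add_self
      rw [ENNReal.ofReal_div_of_pos (by norm_num), ENNReal.le_div_iff_mul_le (by simp) (by simp)]
      simpa [mul_comm] using h
  have hM : ∀ t, dyadicMaximal N t ≤ dyadicMaximal N₁ t + ENNReal.ofReal (l / 2) := by
    intro t
    refine iSup_le fun k => ?_
    have hpos : (0 : ℝ) < 2 ^ k := by positivity
    have hpos' : ENNReal.ofReal ((2 : ℝ) ^ k) ≠ 0 := by simpa using hpos
    calc _ ≤ (∫⁻ z in Metric.closedBall 0 ((2 : ℝ) ^ k), (N₁ (t - z) + ENNReal.ofReal (l / 4)))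
          / ENNReal.ofReal ((2 : ℝ) ^ k) := by gcongr with z; exact hle _
      _ = (∫⁻ z in Metric.closedBall 0 ((2 : ℝ) ^ k), N₁ (t - z)) / ENNReal.ofReal ((2 : ℝ) ^ k)
          + ENNReal.ofReal (l / 2) := by
        rw [lintegral_add_right _ measurable_const, ENNReal.add_div]
        congr 1
        rw [lintegral_const, Measure.restrict_apply MeasurableSet.univ, Set.univ_inter,
          Real.volume_closedBall, ← ENNReal.ofReal_mul (by positivity),
          ← ENNReal.ofReal_div_of_pos hpos]
        congr 1
        field_simp
        norm_num
      _ ≤ _ := by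
        gcongr
        exact le_iSup (fun k : ℤ => (∫⁻ z in Metric.closedBall 0 ((2 : ℝ) ^ k), N₁ (t - z)) /
          ENNReal.ofReal ((2 : ℝ) ^ k)) k
  have hsub : {t | ENNReal.ofReal l < dyadicMaximal N t} ⊆
      {t | ENNReal.ofReal (l / 2) < dyadicMaximal N₁ t} := by
    intro t (ht : ENNReal.ofReal l < dyadicMaximal N t)
    by_contra h
    have h : dyadicMaximal N₁ t ≤ ENNReal.ofReal (l / 2) := not_lt.1 h
    refine absurd ht (not_lt.2 ((hM t).trans ((add_le_add_left h _).trans ?_)))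
    rw [← ENNReal.ofReal_add (by positivity) (by positivity), add_halves]
  calc ENNReal.ofReal l * volume {t | ENNReal.ofReal l < dyadicMaximal N t}
      ≤ ENNReal.ofReal l * volume {t | ENNReal.ofReal (l / 2) < dyadicMaximal N₁ t} := by
        gcongr
    _ = 2 * (ENNReal.ofReal (l / 2) *
          volume {t | ENNReal.ofReal (l / 2) < dyadicMaximal N₁ t}) := by
        rw [← mul_assoc]
        congr 1
        rw [show (2 : ENNReal) = ENNReal.ofReal 2 by simp, ← ENNReal.ofReal_mul (by norm_num)]
        congr 1
        ring
    _ ≤ 2 * (10 * ∫⁻ t, N₁ t) := by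
        gcongr 2 * ?_
        exact mul_measure_lt_dyadicMaximal_le N₁ (half_pos hl)
    _ = 20 * ∫⁻ t, N₁ t := by rw [← mul_assoc]; norm_num

/-- The maximal function is bounded on `L^q`. -/
theorem lintegral_dyadicMaximal_rpow_le {q : ℝ} (hq : 1 < q) {N : ℝ → ENNReal}
    (hN : Measurable N) :
    ∫⁻ t, dyadicMaximal N t ^ q ≤
      ENNReal.ofReal (q * 20 * 4 ^ (q - 1) / (q - 1)) * ∫⁻ t, N t ^ q := by
  have hq0 : 0 < q := by linarith
  have hq1 : 0 < q - 1 := by linarith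
  have hqe : ENNReal.ofReal q ≠ 0 := by simpa using hq0
  have hMm := measurable_dyadicMaximal hN
  have hset : MeasurableSet {p : ℝ × ℝ | ENNReal.ofReal p.2 < dyadicMaximal N p.1} :=
    measurableSet_lt (ENNReal.measurable_ofReal.comp measurable_snd) (hMm.comp measurable_fst)
  have hset' : MeasurableSet {p : ℝ × ℝ | ENNReal.ofReal p.2 < 4 * N p.1} :=
    measurableSet_lt (ENNReal.measurable_ofReal.comp measurable_snd)
      (measurable_const.mul (hN.comp measurable_fst))
  have hw : ∀ a : ℝ, Measurable fun l : ℝ => ENNReal.ofReal (l ^ a) := fun a =>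
    ENNReal.measurable_ofReal.comp (measurable_id.pow_const a)
  calc ∫⁻ t, dyadicMaximal N t ^ q
      = ∫⁻ t, ENNReal.ofReal q * ∫⁻ l in Set.Ioi (0 : ℝ),
          {l : ℝ | ENNReal.ofReal l < dyadicMaximal N t}.indicator
            (fun l => ENNReal.ofReal (l ^ (q - 1))) l := by
        congr 1; ext t
        rw [lintegral_Ioi_indicator_rpow _ hq0, ENNReal.mul_div_cancel hqe ENNReal.ofReal_ne_top]
    _ = ENNReal.ofReal q * ∫⁻ l in Set.Ioi (0 : ℝ), ∫⁻ t,
          {t : ℝ | ENNReal.ofReal l < dyadicMaximal N t}.indicator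
            (fun _ => ENNReal.ofReal (l ^ (q - 1))) t := by
        rw [lintegral_const_mul' _ _ ENNReal.ofReal_ne_top, lintegral_lintegral_swap]
        · rfl
        · exact (((hw _).comp measurable_snd).indicator hset).aemeasurable
    _ = ENNReal.ofReal q * ∫⁻ l in Set.Ioi (0 : ℝ), ENNReal.ofReal (l ^ (q - 1)) *
          volume {t : ℝ | ENNReal.ofReal l < dyadicMaximal N t} := by
        congr 2; ext l
        rw [lintegral_indicator_const (measurableSet_lt measurable_const hMm)]
    _ ≤ ENNReal.ofReal q * ∫⁻ l in Set.Ioi (0 : ℝ), ENNReal.ofReal (l ^ (q - 1 - 1)) *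
          (20 * ∫⁻ t, {t | ENNReal.ofReal l < 4 * N t}.indicator N t) := by
        refine mul_le_mul_right (setLIntegral_mono' measurableSet_Ioi fun l (hl : 0 < l) => ?_) _
        rw [show l ^ (q - 1) = l ^ (q - 1 - 1) * l by
          rw [← Real.rpow_add_one hl.ne']; congr 1; ring,
          ENNReal.ofReal_mul (by positivity), mul_assoc]
        gcongr ENNReal.ofReal _ * ?_
        exact mul_measure_lt_dyadicMaximal_le_truncated N hl
    _ = ENNReal.ofReal q * (20 * ∫⁻ l in Set.Ioi (0 : ℝ), ∫⁻ t, 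
          {t | ENNReal.ofReal l < 4 * N t}.indicator
            (fun t => ENNReal.ofReal (l ^ (q - 1 - 1)) * N t) t) := by
        rw [← lintegral_const_mul' 20 _ (by simp)]
        congr 2; ext l
        rw [mul_left_comm, ← lintegral_const_mul' _ _ ENNReal.ofReal_ne_top]
        congr 1
        refine lintegral_congr fun t => ?_
        simp only [Set.indicator]
        split_ifs <;> simp
    _ = ENNReal.ofReal q * (20 * ∫⁻ t, N t * ∫⁻ l in Set.Ioi (0 : ℝ), 
          {l : ℝ | ENNReal.ofReal l < 4 * N t}.indicator
            (fun l => ENNReal.ofReal (l ^ (q - 1 - 1))) l) := by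
        rw [← lintegral_lintegral_swap]
        · congr 2
          refine lintegral_congr fun t => ?_
          rw [← lintegral_const_mul]
          · congr 1; ext l
            simp only [Set.indicator, Set.mem_ofPred_eq]
            split_ifs <;> simp [mul_comm]
          · exact (hw _).indicator (measurableSet_lt ENNReal.measurable_ofReal measurable_const)
        · exact ((((hw _).comp measurable_snd).mul (hN.comp measurable_fst)).indicator
            hset').aemeasurable
    _ = ENNReal.ofReal q * (20 * ∫⁻ t, N t ^ q * ENNReal.ofReal (4 ^ (q - 1) / (q - 1))) := by
        congr 2
        refine lintegral_congr fun t => ?_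
        rw [lintegral_Ioi_indicator_rpow _ hq1, ENNReal.mul_rpow_of_nonneg _ _ hq1.le,
          ENNReal.ofReal_div_of_pos hq1, ← ENNReal.ofReal_rpow_of_pos (by norm_num),
          show q = 1 + (q - 1) by ring, ENNReal.rpow_add_of_nonneg _ _ zero_le_one hq1.le,
          ENNReal.rpow_one, ← show q = 1 + (q - 1) by ring]
        simp only [div_eq_mul_inv, ENNReal.ofReal_ofNat]
        ring
    _ = _ := by
        rw [lintegral_mul_const' _ _ ENNReal.ofReal_ne_top, mul_div_assoc, mul_assoc,
          ENNReal.ofReal_mul hq0.le, ENNReal.ofReal_mul (by norm_num), ENNReal.ofReal_ofNat]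
        ring

/-- Hedberg's splitting of the Riesz potential of order `α` at scale `l`. -/
theorem lintegral_rpow_mul_le_dyadicMaximal {α q : ℝ} (hα : 0 < α) (hα1 : α < 1) (hq : 1 < q)
    (hαq : α < 1 / q) {N : ℝ → ENNReal} (hN : Measurable N) (t : ℝ) {l : ℝ} (hl : 0 < l) :
    ∫⁻ z, ENNReal.ofReal (|z| ^ (α - 1)) * N (t - z) ≤
      ENNReal.ofReal (l ^ α) * (ENNReal.ofReal (2 / α) * dyadicMaximal N t) +
      ENNReal.ofReal (l ^ (-(1 / q - α))) *
        (ENNReal.ofReal (2 / (1 / q - α)) * (∫⁻ z, N z ^ q) ^ (1 / q)) := by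
  have hq0 : 0 < q := by linarith
  have hα1' : 0 < 1 - α := by linarith
  have hγ : 0 < 1 / q - α := by linarith
  have hq1 : 0 ≤ 1 - 1 / q := by rw [sub_nonneg, div_le_one hq0]; exact hq.le
  set A : ℝ → ENNReal := fun ρ => ∫⁻ z in Metric.closedBall 0 ρ, N (t - z) with hA
  have hw : ∀ a : ℝ, Measurable fun l : ℝ => ENNReal.ofReal (l ^ a) := fun a =>
    ENNReal.measurable_ofReal.comp (measurable_id.pow_const a)
  have hset : MeasurableSet {p : ℝ × ℝ | |p.1| < p.2} :=
    measurableSet_lt measurable_fst.abs measurable_snd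
  have hNt : Measurable fun z => N (t - z) := hN.comp (measurable_const.sub measurable_id)
  have hA1 : ∀ ρ, 0 < ρ → A ρ ≤ ENNReal.ofReal (2 * ρ) * dyadicMaximal N t := by
    intro ρ hρ
    obtain ⟨k, hk1, hk2⟩ := exists_mem_Ioc_zpow hρ (one_lt_two (α := ℝ))
    have h2 : (0 : ℝ) < 2 ^ (k + 1) := by positivity
    calc A ρ ≤ ∫⁻ z in Metric.closedBall 0 ((2 : ℝ) ^ (k + 1)), N (t - z) :=
          lintegral_mono_set (Metric.closedBall_subset_closedBall hk2)
      _ ≤ ENNReal.ofReal ((2 : ℝ) ^ (k + 1)) * dyadicMaximal N t := by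
          rw [mul_comm, ← ENNReal.div_le_iff_le_mul (Or.inl (by simpa using h2))
            (Or.inl ENNReal.ofReal_ne_top)]
          exact le_iSup (fun k : ℤ => (∫⁻ z in Metric.closedBall 0 ((2 : ℝ) ^ k), N (t - z)) /
            ENNReal.ofReal ((2 : ℝ) ^ k)) (k + 1)
      _ ≤ _ := by
          gcongr
          rw [zpow_add_one₀ (by norm_num), mul_comm]
          gcongr
  have hA2 : ∀ ρ, 0 < ρ → A ρ ≤ ENNReal.ofReal (2 * ρ ^ (1 - 1 / q)) *
      (∫⁻ z, N z ^ q) ^ (1 / q) := by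
    intro ρ hρ
    have hc : q.HolderConjugate (q / (q - 1)) := Real.HolderConjugate.conjExponent hq
    have hq'1 : 1 / (q / (q - 1)) = 1 - 1 / q := by field_simp
    have := ENNReal.lintegral_mul_le_Lp_mul_Lq (volume.restrict (Metric.closedBall (0 : ℝ) ρ)) hc
      (f := fun z => N (t - z)) (g := fun _ => 1) hNt.aemeasurable aemeasurable_const
    simp only [Pi.mul_apply, mul_one, hq'1, ENNReal.one_rpow, lintegral_const,
      Measure.restrict_apply MeasurableSet.univ, Set.univ_inter, one_mul] at this
    refine this.trans ?_
    rw [mul_comm, Real.volume_closedBall, ENNReal.ofReal_rpow_of_nonneg (by positivity) hq1,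
      Real.mul_rpow (by norm_num) hρ.le]
    gcongr ENNReal.ofReal (?_ * _) * ?_ ^ _
    · calc (2 : ℝ) ^ (1 - 1 / q) ≤ 2 ^ (1 : ℝ) := by
            apply Real.rpow_le_rpow_of_exponent_le (by norm_num)
            have : 0 < 1 / q := by positivity
            linarith
        _ = 2 := by norm_num
    · rw [← lintegral_sub_left_eq_self (fun z => N z ^ q) t]
      exact setLIntegral_le_lintegral _ _
  calc ∫⁻ z, ENNReal.ofReal (|z| ^ (α - 1)) * N (t - z)
      = ∫⁻ z, ∫⁻ ρ in Set.Ioi (0 : ℝ), {ρ : ℝ | |z| < ρ}.indicator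
          (fun ρ => ENNReal.ofReal (1 - α) * ENNReal.ofReal (ρ ^ (-(1 - α) - 1)) * N (t - z)) ρ := by
        refine lintegral_congr_ae ?_
        have : ∀ᵐ z : ℝ, z ≠ 0 := by simp [ae_iff]
        filter_upwards [this] with z hz
        have hz' : 0 < |z| := abs_pos.2 hz
        have hs : MeasurableSet {ρ : ℝ | |z| < ρ} := measurableSet_Ioi
        rw [lintegral_indicator hs, Measure.restrict_restrict hs,
          show {ρ : ℝ | |z| < ρ} ∩ Set.Ioi 0 = Set.Ioi |z| from
            Set.inter_eq_left.2 fun x hx => hz'.trans hx,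
          lintegral_mul_const _ ((hw _).const_mul _), lintegral_const_mul _ (hw _),
          lintegral_Ioi_rpow_neg hz' hα1', ← ENNReal.ofReal_mul hα1'.le]
        congr 2
        rw [mul_div_cancel₀ _ hα1'.ne']
        congr 1; ring
    _ = ∫⁻ ρ in Set.Ioi (0 : ℝ), ∫⁻ z, {z : ℝ | |z| < ρ}.indicator
          (fun z => ENNReal.ofReal (1 - α) * ENNReal.ofReal (ρ ^ (-(1 - α) - 1)) * N (t - z)) z := by
        rw [lintegral_lintegral_swap]
        · rfl
        · exact (((((hw _).comp measurable_snd).const_mul _).mul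
            (hNt.comp measurable_fst)).indicator hset).aemeasurable
    _ ≤ ∫⁻ ρ in Set.Ioi (0 : ℝ), ENNReal.ofReal (ρ ^ (α - 2)) * A ρ := by
        refine setLIntegral_mono' measurableSet_Ioi fun ρ (hρ : 0 < ρ) => ?_
        have hs : MeasurableSet {z : ℝ | |z| < ρ} :=
          measurableSet_lt measurable_id.abs measurable_const
        rw [lintegral_indicator hs, lintegral_const_mul _ hNt, ← ENNReal.ofReal_mul hα1'.le]
        refine mul_le_mul' (ENNReal.ofReal_le_ofReal ?_) (lintegral_mono_set fun z hz => ?_)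
        · rw [show -(1 - α) - 1 = α - 2 by ring]
          exact mul_le_of_le_one_left (by positivity) (by linarith)
        · have hz : |z| < ρ := hz
          simpa using hz.le
    _ = (∫⁻ ρ in Set.Ioc 0 l, ENNReal.ofReal (ρ ^ (α - 2)) * A ρ) +
        ∫⁻ ρ in Set.Ioi l, ENNReal.ofReal (ρ ^ (α - 2)) * A ρ := by
        rw [← Set.Ioc_union_Ioi_eq_Ioi hl.le, lintegral_union measurableSet_Ioi]
        exact Set.Ioc_disjoint_Ioi le_rfl
    _ ≤ (∫⁻ ρ in Set.Ioc 0 l, ENNReal.ofReal (ρ ^ (α - 1)) *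
          (2 * dyadicMaximal N t)) +
        ∫⁻ ρ in Set.Ioi l, ENNReal.ofReal (ρ ^ (-(1 / q - α) - 1)) *
          (2 * (∫⁻ z, N z ^ q) ^ (1 / q)) := by
        refine add_le_add (setLIntegral_mono' measurableSet_Ioc fun ρ hρ => ?_)
          (setLIntegral_mono' measurableSet_Ioi fun ρ hρ => ?_)
        · have hρ0 : 0 < ρ := hρ.1
          refine (mul_le_mul_right (hA1 ρ hρ0) _).trans_eq ?_
          rw [show α - 1 = α - 2 + 1 by ring, Real.rpow_add_one hρ0.ne',
            ENNReal.ofReal_mul (Real.rpow_nonneg hρ0.le _),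
            ENNReal.ofReal_mul (by norm_num), ENNReal.ofReal_ofNat]
          ring
        · have hρ0 : 0 < ρ := hl.trans hρ
          refine (mul_le_mul_right (hA2 ρ hρ0) _).trans_eq ?_
          rw [show -(1 / q - α) - 1 = α - 2 + (1 - 1 / q) by ring, Real.rpow_add hρ0,
            ENNReal.ofReal_mul (Real.rpow_nonneg hρ0.le _),
            ENNReal.ofReal_mul (by norm_num), ENNReal.ofReal_ofNat]
          ring
    _ = _ := by
        rw [lintegral_mul_const _ (hw _), lintegral_mul_const _ (hw _),
          lintegral_Ioc_rpow hl.le hα, lintegral_Ioi_rpow_neg hl hγ]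
        congr 1
        · rw [ENNReal.ofReal_div_of_pos hα, ENNReal.ofReal_div_of_pos hα, ENNReal.ofReal_ofNat]
          simp only [div_eq_mul_inv]; ring
        · rw [ENNReal.ofReal_div_of_pos hγ, ENNReal.ofReal_div_of_pos hγ, ENNReal.ofReal_ofNat]
          simp only [div_eq_mul_inv]; ring

/-- **Hedberg's inequality** for the Riesz potential of order `1 / q - 1 / s`. -/
theorem lintegral_rpow_mul_le_dyadicMaximal_rpow {q s : ℝ} (hq : 1 < q) (hs : q < s)
    {N : ℝ → ENNReal} (hN : Measurable N) (h0 : ∫⁻ z, N z ^ q ≠ 0) (ht : ∫⁻ z, N z ^ q ≠ ⊤)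
    (t : ℝ) :
    ∫⁻ z, ENNReal.ofReal (|z| ^ (1 / q - 1 / s - 1)) * N (t - z) ≤
      ENNReal.ofReal (2 / (1 / q - 1 / s) + 2 * s) *
        (dyadicMaximal N t ^ (q / s) * ((∫⁻ z, N z ^ q) ^ (1 / q)) ^ (1 - q / s)) := by
  have hq0 : 0 < q := by linarith
  have hs0 : 0 < s := by linarith
  set α := 1 / q - 1 / s with hαdef
  have hα : 0 < α := sub_pos.2 (one_div_lt_one_div_of_lt hq0 hs)
  have hqi : 1 / q < 1 := by rw [div_lt_one hq0]; exact hq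
  have hsi : 0 < 1 / s := by positivity
  have hγ : 1 / q - α = 1 / s := by rw [hαdef]; ring
  have hqs1 : q / s < 1 := by rw [div_lt_one hs0]; exact hs
  have key := fun {l : ℝ} (hl : 0 < l) => lintegral_rpow_mul_le_dyadicMaximal hα
    (by linarith) hq (by linarith) hN t hl
  rw [hγ] at key
  set B := (∫⁻ z, N z ^ q) ^ (1 / q) with hB
  have hB0 : B ≠ 0 := by
    rw [hB, Ne, ENNReal.rpow_eq_zero_iff_of_pos (by positivity)]; exact h0
  have hBt : B ≠ ⊤ := ENNReal.rpow_ne_top_of_nonneg (by positivity) ht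
  set M := dyadicMaximal N t with hM
  have hC0 : ENNReal.ofReal (2 / α + 2 * s) ≠ 0 := by
    have : 0 < 2 / α + 2 * s := by positivity
    simpa using this
  have hMzero : M ≠ 0 := by
    intro h
    have h1 : ∀ k : ℤ, ∫⁻ z in Metric.closedBall 0 ((2 : ℝ) ^ k), N (t - z) = 0 := by
      intro k
      have h2 := (ENNReal.iSup_eq_zero.1 h) k
      rcases ENNReal.div_eq_zero_iff.1 h2 with h3 | h3
      · exact h3
      · exact absurd h3 ENNReal.ofReal_ne_top
    have h2 : ∀ᵐ z, N (t - z) = 0 := by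
      have h3 : ∀ᵐ z, ∀ k : ℕ, z ∈ Metric.closedBall (0 : ℝ) ((2 : ℝ) ^ (k : ℤ)) →
          N (t - z) = 0 := by
        refine ae_all_iff.2 fun k => ?_
        rw [← ae_restrict_iff' Metric.isClosed_closedBall.measurableSet]
        exact (lintegral_eq_zero_iff (hN.comp (measurable_const.sub measurable_id))).1 (h1 k)
      filter_upwards [h3] with z hz
      obtain ⟨k, hk⟩ := pow_unbounded_of_one_lt |z| (one_lt_two (α := ℝ))
      exact hz k (by simpa using hk.le)
    refine h0 ?_
    rw [← lintegral_sub_left_eq_self (fun z => N z ^ q) t]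
    rw [lintegral_congr_ae (g := fun _ => 0) (h2.mono fun z hz => by simp [hz, hq0])]
    simp
  by_cases hMt : M = ⊤
  · rw [hMt, ENNReal.top_rpow_of_pos (by positivity), ENNReal.top_mul, ENNReal.mul_top hC0]
    · exact le_top
    · rw [Ne, ENNReal.rpow_eq_zero_iff_of_pos (by linarith)]; exact hB0
  set l := (((B / M) ^ q).toReal) with hl
  have hBM0 : B / M ≠ 0 := ENNReal.div_ne_zero.2 ⟨hB0, hMt⟩
  have hBMt : B / M ≠ ⊤ := ENNReal.div_ne_top hBt hMzero
  have hBMq0 : (B / M) ^ q ≠ 0 := by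
    rw [Ne, ENNReal.rpow_eq_zero_iff_of_pos hq0]; exact hBM0
  have hBMqt : (B / M) ^ q ≠ ⊤ := ENNReal.rpow_ne_top_of_nonneg hq0.le hBMt
  have hl0 : 0 < l := ENNReal.toReal_pos hBMq0 hBMqt
  have hlp : ∀ a, ENNReal.ofReal (l ^ a) = B ^ (q * a) * M ^ (-(q * a)) := by
    intro a
    rw [← ENNReal.ofReal_rpow_of_pos hl0, hl, ENNReal.ofReal_toReal hBMqt, ← ENNReal.rpow_mul,
      div_eq_mul_inv, ENNReal.mul_rpow_of_ne_top hBt (ENNReal.inv_ne_top.2 hMzero),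
      ENNReal.inv_rpow, ENNReal.rpow_neg]
  refine (key hl0).trans_eq ?_
  rw [hlp, hlp]
  have e1 : B ^ (q * α) * M ^ (-(q * α)) * (ENNReal.ofReal (2 / α) * M) =
      ENNReal.ofReal (2 / α) * (M ^ (q / s) * B ^ (1 - q / s)) := by
    rw [show q / s = -(q * α) + 1 by rw [hαdef]; field_simp; ring, ENNReal.rpow_add _ _ hMzero hMt,
      ENNReal.rpow_one, show 1 - (-(q * α) + 1) = q * α by ring]
    ring
  have e2 : B ^ (q * -(1 / s)) * M ^ (-(q * -(1 / s))) * (ENNReal.ofReal (2 / (1 / s)) * B) =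
      ENNReal.ofReal (2 * s) * (M ^ (q / s) * B ^ (1 - q / s)) := by
    rw [show 1 - q / s = q * -(1 / s) + 1 by ring, ENNReal.rpow_add _ _ hB0 hBt,
      ENNReal.rpow_one, show -(q * -(1 / s)) = q / s by ring,
      show 2 / (1 / s) = 2 * s by field_simp]
    ring
  rw [e1, e2, ENNReal.ofReal_add (by positivity) (by positivity)]
  ring

/-- The **Hardy-Littlewood-Sobolev inequality** on the line. -/
theorem exists_lintegral_rpow_mul_rpow_le {q s : ℝ} (hq : 1 < q) (hs : q < s) :
    ∃ C : NNReal, ∀ N : ℝ → ENNReal, Measurable N →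
      (∫⁻ t, (∫⁻ z, ENNReal.ofReal (|z| ^ (1 / q - 1 / s - 1)) * N (t - z)) ^ s) ^ (1 / s) ≤
        C * (∫⁻ t, N t ^ q) ^ (1 / q) := by
  have hq0 : 0 < q := by linarith
  have hs0 : 0 < s := by linarith
  have hqs1 : 0 < 1 - q / s := by rw [sub_pos, div_lt_one hs0]; exact hs
  set c₁ := ENNReal.ofReal (2 / (1 / q - 1 / s) + 2 * s)
  set c₂ := ENNReal.ofReal (q * 20 * 4 ^ (q - 1) / (q - 1))
  have hc : (1 + c₁) * c₂ ^ (1 / s) ≠ ⊤ :=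
    ENNReal.mul_ne_top (by simp [c₁]) (ENNReal.rpow_ne_top_of_nonneg (by positivity) (by simp [c₂]))
  have hc0 : (1 + c₁) * c₂ ^ (1 / s) ≠ 0 := by
    have : 0 < q * 20 * 4 ^ (q - 1) / (q - 1) := by
      have : 0 < q - 1 := by linarith
      positivity
    refine mul_ne_zero (by simp) ?_
    rw [Ne, ENNReal.rpow_eq_zero_iff_of_pos (by positivity)]
    simpa [c₂] using this
  refine ⟨((1 + c₁) * c₂ ^ (1 / s)).toNNReal, fun N hN => ?_⟩
  rw [ENNReal.coe_toNNReal hc]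
  by_cases h0 : ∫⁻ z, N z ^ q = 0
  · have h1 : ∀ᵐ z, N z = 0 := by
      filter_upwards [(lintegral_eq_zero_iff (hN.pow_const q)).1 h0] with z hz
      simpa [hq0, hq0.le, not_lt.2 hq0.le] using hz
    have h2 : ∀ t, ∫⁻ z, ENNReal.ofReal (|z| ^ (1 / q - 1 / s - 1)) * N (t - z) = 0 := by
      intro t
      have h3 : ∀ᵐ z, N (t - z) = 0 :=
        (quasiMeasurePreserving_sub_left volume t).ae h1
      rw [lintegral_congr_ae (g := fun _ => 0) (h3.mono fun z hz => by simp [hz])]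
      simp
    simp only [h2, ENNReal.zero_rpow_of_pos hs0, lintegral_zero,
      ENNReal.zero_rpow_of_pos (one_div_pos.2 hs0)]
    exact zero_le
  by_cases ht : ∫⁻ z, N z ^ q = ⊤
  · rw [ht, ENNReal.top_rpow_of_pos (by positivity), ENNReal.mul_top hc0]; exact le_top
  set B := (∫⁻ z, N z ^ q) ^ (1 / q) with hB
  have hB0 : B ≠ 0 := by
    rw [hB, Ne, ENNReal.rpow_eq_zero_iff_of_pos (by positivity)]; exact h0
  have hBt : B ≠ ⊤ := ENNReal.rpow_ne_top_of_nonneg (by positivity) ht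
  have hBq : ∫⁻ z, N z ^ q = B ^ q := by
    rw [hB, ← ENNReal.rpow_mul, one_div_mul_cancel hq0.ne', ENNReal.rpow_one]
  clear_value B
  have hmain : ∫⁻ t, (∫⁻ z, ENNReal.ofReal (|z| ^ (1 / q - 1 / s - 1)) * N (t - z)) ^ s ≤
      (c₁ * c₂ ^ (1 / s) * B) ^ s := by
    calc _ ≤ ∫⁻ t, (c₁ * B ^ (1 - q / s)) ^ s * dyadicMaximal N t ^ q := by
          refine lintegral_mono fun t => ?_
          refine (ENNReal.rpow_le_rpow
            (lintegral_rpow_mul_le_dyadicMaximal_rpow hq hs hN h0 ht t) hs0.le).trans_eq ?_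
          rw [mul_left_comm, ENNReal.mul_rpow_of_nonneg _ _ hs0.le, ← ENNReal.rpow_mul,
            div_mul_cancel₀ _ hs0.ne', mul_comm, ← hB]
      _ = (c₁ * B ^ (1 - q / s)) ^ s * ∫⁻ t, dyadicMaximal N t ^ q :=
          lintegral_const_mul _ ((measurable_dyadicMaximal hN).pow_const q)
      _ ≤ (c₁ * B ^ (1 - q / s)) ^ s * (c₂ * B ^ q) := by
          gcongr
          rw [← hBq]
          exact lintegral_dyadicMaximal_rpow_le hq hN
      _ = _ := by
          rw [ENNReal.mul_rpow_of_nonneg _ _ hs0.le, ENNReal.mul_rpow_of_nonneg _ _ hs0.le,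
            ENNReal.mul_rpow_of_nonneg _ _ hs0.le, ← ENNReal.rpow_mul, ← ENNReal.rpow_mul,
            one_div_mul_cancel hs0.ne', ENNReal.rpow_one,
            show (1 - q / s) * s = s - q by field_simp,
            show B ^ s = B ^ (s - q) * B ^ q by
              rw [← ENNReal.rpow_add _ _ hB0 hBt]; congr 1; ring]
          ring
  calc _ ≤ ((c₁ * c₂ ^ (1 / s) * B) ^ s) ^ (1 / s) := by gcongr
    _ = c₁ * c₂ ^ (1 / s) * B := by
        rw [← ENNReal.rpow_mul, mul_one_div_cancel hs0.ne', ENNReal.rpow_one]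
    _ ≤ _ := by gcongr; exact le_add_self

theorem hasDerivAt_inv_sqrt_add {ε σ : ℝ} (h : 0 < σ + ε) :
    HasDerivAt (fun σ => (√(σ + ε))⁻¹) (-(1 / 2) * (√(σ + ε))⁻¹ ^ 3) σ := by
  have hs : √(σ + ε) ≠ 0 := (Real.sqrt_pos.2 h).ne'
  have h1 := (((hasDerivAt_id σ).add_const ε).sqrt h.ne').inv hs
  refine h1.congr_deriv ?_
  simp only [id]
  field_simp

theorem inv_sqrt_add_pow_mul_rpow_le {σ ε P R : ℝ} (hσ : 0 < σ) (hε : 0 ≤ ε) (h : R ≤ P) (n : ℕ) :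
    (√(σ + ε))⁻¹ ^ (n + 1) * (√(σ + ε) ^ n) ^ (1 - P + R)
      ≤ σ ^ (-(1 / 2) - (n : ℝ) / 2 * (P - R)) := by
  have h0 : 0 < σ + ε := by linarith
  have h1 : 0 ≤ (n : ℝ) / 2 * (P - R) := mul_nonneg (by positivity) (by linarith)
  rw [Real.sqrt_eq_rpow, ← Real.rpow_neg h0.le, ← Real.rpow_natCast, ← Real.rpow_natCast,
    ← Real.rpow_mul h0.le, ← Real.rpow_mul h0.le, ← Real.rpow_mul h0.le, ← Real.rpow_add h0]
  refine le_trans (le_of_eq ?_) (Real.rpow_le_rpow_of_nonpos hσ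
    (by linarith : σ ≤ σ + ε) (by linarith))
  congr 1
  push_cast
  ring

section Dilation

variable {E : Type*} [NormedAddCommGroup E] [NormedSpace ℝ E] [FiniteDimensional ℝ E]
  [MeasurableSpace E] [BorelSpace E]

theorem integral_mul_fderiv_eq_neg_of_contDiff (μ : Measure E) [μ.IsAddHaarMeasure]
    {f g : E → ℝ} (hf : ContDiff ℝ 1 f) (hfc : HasCompactSupport f) (hg : ContDiff ℝ 1 g)
    (v : E) : ∫ x, f x * fderiv ℝ g x v ∂μ = - ∫ x, fderiv ℝ f x v * g x ∂μ := by
  have hf' : Continuous fun x => fderiv ℝ f x v :=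
    (hf.continuous_fderiv one_ne_zero).clm_apply continuous_const
  have hg' : Continuous fun x => fderiv ℝ g x v :=
    (hg.continuous_fderiv one_ne_zero).clm_apply continuous_const
  exact integral_mul_fderiv_eq_neg_fderiv_mul_of_integrable
    ((hf'.mul hg.continuous).integrable_of_hasCompactSupport
      ((hfc.fderiv_apply ℝ v).mul_right))
    ((hf.continuous.mul hg').integrable_of_hasCompactSupport hfc.mul_right)
    ((hf.continuous.mul hg.continuous).integrable_of_hasCompactSupport hfc.mul_right)
    (fun x _ => hf.differentiable one_ne_zero x) (fun x _ => hg.differentiable one_ne_zero x)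

theorem integral_dilation_generator_mul (μ : Measure E) [μ.IsAddHaarMeasure]
    {k w : E → ℝ} (hk : ContDiff ℝ 1 k) (hkc : HasCompactSupport k) (hw : ContDiff ℝ 1 w) :
    ∫ x, (Module.finrank ℝ E * k x + fderiv ℝ k x x) * w x ∂μ
      = - ∫ x, k x * fderiv ℝ w x x ∂μ := by
  classical
  set b := Module.finBasis ℝ E
  let c : Fin (Module.finrank ℝ E) → (E →L[ℝ] ℝ) := fun i => (b.coord i).toContinuousLinearMap
  have hsum : ∀ x : E, x = ∑ i, c i x • b i := fun x => (b.sum_repr x).symm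
  have hcb : ∀ i, c i (b i) = 1 := fun i => by simp [c]
  have hk' : ∀ v, Continuous fun x => fderiv ℝ k x v := fun v =>
    (hk.continuous_fderiv one_ne_zero).clm_apply continuous_const
  have hw' : ∀ v, Continuous fun x => fderiv ℝ w x v := fun v =>
    (hw.continuous_fderiv one_ne_zero).clm_apply continuous_const
  have hint : ∀ {h : E → ℝ}, Continuous h → Integrable (fun x => k x * h x) μ := fun hh =>
    (hk.continuous.mul hh).integrable_of_hasCompactSupport hkc.mul_right
  have hint' : ∀ v, ∀ {h : E → ℝ}, Continuous h →
      Integrable (fun x => fderiv ℝ k x v * h x) μ := fun v h hh =>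
    ((hk' v).mul hh).integrable_of_hasCompactSupport (hkc.fderiv_apply ℝ v).mul_right
  have hA : ∀ i, Integrable (fun x => k x * (c i x * fderiv ℝ w x (b i))) μ := fun i =>
    hint ((c i).continuous.mul (hw' _))
  have hB : ∀ i, Integrable (fun x => fderiv ℝ k x (b i) * (c i x * w x)) μ := fun i =>
    hint' _ ((c i).continuous.mul hw.continuous)
  have key : ∀ i, ∫ x, k x * w x ∂μ + ∫ x, k x * (c i x * fderiv ℝ w x (b i)) ∂μ
      = - ∫ x, fderiv ℝ k x (b i) * (c i x * w x) ∂μ := by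
    intro i
    rw [← integral_mul_fderiv_eq_neg_of_contDiff μ hk hkc ((c i).contDiff.mul hw) (b i),
      ← integral_add (hint hw.continuous) (hA i)]
    refine integral_congr_ae (Filter.Eventually.of_forall fun x => ?_)
    have := ((c i).hasFDerivAt (x := x)).mul (hw.differentiable one_ne_zero x).hasFDerivAt
    have h2 : fderiv ℝ (fun x => c i x * w x) x = _ := this.fderiv
    simp only [h2, _root_.add_apply, _root_.smul_apply, hcb, smul_eq_mul]
    ring
  have hs := Finset.sum_congr rfl (fun i (_ : i ∈ Finset.univ) => key i)
  rw [Finset.sum_add_distrib, Finset.sum_const, Finset.card_univ, Fintype.card_fin,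
    ← integral_finsetSum _ (fun i _ => hA i),
    Finset.sum_neg_distrib,
    ← integral_finsetSum _ (fun i _ => hB i)] at hs
  have e1 : ∀ x, ∑ i, k x * (c i x * fderiv ℝ w x (b i)) = k x * fderiv ℝ w x x := by
    intro x
    conv_rhs => rw [hsum x]
    simp_rw [← Finset.mul_sum, map_sum, map_smul, smul_eq_mul]
    rw [← hsum x]
  have e2 : ∀ x, ∑ i, fderiv ℝ k x (b i) * (c i x * w x) = fderiv ℝ k x x * w x := by
    intro x
    have : fderiv ℝ k x x = ∑ i, c i x * fderiv ℝ k x (b i) := by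
      have h3 : fderiv ℝ k x x = fderiv ℝ k x (∑ i, c i x • b i) := by rw [← hsum x]
      simpa [map_sum] using h3
    rw [this, Finset.sum_mul]
    exact Finset.sum_congr rfl fun i _ => by ring
  simp_rw [e1, e2] at hs
  have hi3 : Integrable (fun x => fderiv ℝ k x x * w x) μ := by
    simp_rw [← e2]
    exact integrable_finsetSum _ fun i _ => hB i
  have : ∀ x, (Module.finrank ℝ E * k x + fderiv ℝ k x x) * w x
      = Module.finrank ℝ E * (k x * w x) + fderiv ℝ k x x * w x := fun x => by ring
  simp_rw [this]
  rw [integral_add ((hint hw.continuous).const_mul _) hi3, integral_const_mul]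
  rw [nsmul_eq_mul] at hs
  linarith

theorem integral_dilation_generator_fderiv_mul (μ : Measure E) [μ.IsAddHaarMeasure]
    {f w : E → ℝ} (hf : ContDiff ℝ 2 f) (hfc : HasCompactSupport f) (hw : ContDiff ℝ 2 w)
    (e : E) :
    ∫ x, ((Module.finrank ℝ E + 1) * fderiv ℝ f x e
        + fderiv ℝ (fun y => fderiv ℝ f y e) x x) * w x ∂μ
      = ∫ x, f x * fderiv ℝ (fun y => fderiv ℝ w y e) x x ∂μ := by
  have hk : ContDiff ℝ 1 fun y => fderiv ℝ f y e :=
    (hf.fderiv_right (m := 1) (by norm_num)).clm_apply contDiff_const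
  have hDw : ContDiff ℝ 1 (fderiv ℝ w) := hw.fderiv_right (m := 1) (by norm_num)
  have hkc : HasCompactSupport fun y => fderiv ℝ f y e := hfc.fderiv_apply ℝ e
  have hw1 : ContDiff ℝ 1 w := hw.of_le (by norm_num)
  have hf1 : ContDiff ℝ 1 f := hf.of_le (by norm_num)
  have h1 := integral_dilation_generator_mul μ hk hkc hw1
  have h2 := integral_mul_fderiv_eq_neg_of_contDiff μ hf1 hfc (hDw.clm_apply contDiff_id) e
  have h3 := integral_mul_fderiv_eq_neg_of_contDiff μ hf1 hfc hw1 e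
  have hd : ∀ x, fderiv ℝ (fun y => fderiv ℝ w y (id y)) x e
      = fderiv ℝ (fun y => fderiv ℝ w y e) x x + fderiv ℝ w x e := by
    intro x
    have hx := (hDw.differentiable one_ne_zero x).hasFDerivAt
    have a1 := (hx.clm_apply (hasFDerivAt_id x)).fderiv
    have a2 := (hx.clm_apply (hasFDerivAt_const e x)).fderiv
    have hsym : fderiv ℝ (fderiv ℝ w) x e x = fderiv ℝ (fderiv ℝ w) x x e :=
      (hw.contDiffAt.isSymmSndFDerivAt (by simp)) e x
    erw [a1]
    rw [a2]
    simp [hsym, add_comm]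
  simp_rw [hd, id] at h2
  have hD2 : Continuous fun x => fderiv ℝ (fun y => fderiv ℝ w y e) x x :=
    ((hDw.clm_apply contDiff_const).continuous_fderiv one_ne_zero).clm_apply continuous_id
  have hint : ∀ {h : E → ℝ}, Continuous h → Integrable (fun x => f x * h x) μ := fun hh =>
    (hf.continuous.mul hh).integrable_of_hasCompactSupport hfc.mul_right
  have hw' : Continuous fun x => fderiv ℝ w x e := hDw.continuous.clm_apply continuous_const
  simp_rw [mul_add] at h2
  rw [integral_add (hint hD2) (hint hw')] at h2
  have hi1 : Integrable (fun x => fderiv ℝ f x e * w x) μ :=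
    (hk.continuous.mul hw.continuous).integrable_of_hasCompactSupport hkc.mul_right
  have hi2 : Integrable (fun x => (Module.finrank ℝ E * fderiv ℝ f x e
      + fderiv ℝ (fun y => fderiv ℝ f y e) x x) * w x) μ := by
    refine Continuous.integrable_of_hasCompactSupport ?_ ?_
    · exact ((continuous_const.mul hk.continuous).add
        ((hk.continuous_fderiv one_ne_zero).clm_apply continuous_id)).mul hw.continuous
    · refine HasCompactSupport.mul_right (HasCompactSupport.add hkc.mul_left ?_)
      exact (hkc.fderiv ℝ).mono fun x hx => by
        contrapose! hx
        simp at hx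
        simp [hx]
  have : ∀ x, ((Module.finrank ℝ E + 1) * fderiv ℝ f x e
        + fderiv ℝ (fun y => fderiv ℝ f y e) x x) * w x
      = (Module.finrank ℝ E * fderiv ℝ f x e
        + fderiv ℝ (fun y => fderiv ℝ f y e) x x) * w x + fderiv ℝ f x e * w x := fun x => by ring
  simp_rw [this]
  rw [integral_add hi2 hi1]
  linarith

omit [FiniteDimensional ℝ E] [MeasurableSpace E] [BorelSpace E] in
theorem hasDerivAt_pow_mul_comp_smul {k : E → ℝ} (hk : Differentiable ℝ k) (n : ℕ) (θ : ℝ)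
    (z : E) :
    HasDerivAt (fun θ : ℝ => θ ^ (n + 1) * k (θ • z))
      (θ ^ n * ((n + 1) * k (θ • z) + fderiv ℝ k (θ • z) (θ • z))) θ := by
  have h1 : HasDerivAt (fun θ : ℝ => θ • z) ((1 : ℝ) • z) θ := (hasDerivAt_id θ).smul_const z
  have h2 := (hk (θ • z)).hasFDerivAt.comp_hasDerivAt θ h1
  refine ((hasDerivAt_pow (n + 1) θ).mul h2).congr_deriv ?_
  simp only [Function.comp, one_smul, map_smul, smul_eq_mul, Nat.add_sub_cancel]
  push_cast
  ring

omit [FiniteDimensional ℝ E] [MeasurableSpace E] [BorelSpace E] in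
theorem fderiv_comp_smul_apply {f : E → ℝ} (hf : Differentiable ℝ f) (θ : ℝ) (x v : E) :
    fderiv ℝ (fun y => f (θ • y)) x v = θ * fderiv ℝ f (θ • x) v := by
  have h := (hf (θ • x)).hasFDerivAt.comp x ((hasFDerivAt_id x).const_smul θ)
  have h' : HasFDerivAt (fun y => f (θ • y)) _ x := h
  rw [h'.fderiv]
  simp

theorem integral_dilation_generator_comp_smul_mul (μ : Measure E) [μ.IsAddHaarMeasure]
    {f w : E → ℝ} (hf : ContDiff ℝ 2 f) (hfc : HasCompactSupport f) (hw : ContDiff ℝ 2 w)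
    (e : E) {θ : ℝ} (hθ : θ ≠ 0) :
    θ * ∫ x, ((Module.finrank ℝ E + 1) * fderiv ℝ f (θ • x) e
        + fderiv ℝ (fun y => fderiv ℝ f y e) (θ • x) (θ • x)) * w x ∂μ
      = ∫ x, f (θ • x) * fderiv ℝ (fun y => fderiv ℝ w y e) x x ∂μ := by
  have hk : ContDiff ℝ 1 fun y => fderiv ℝ f y e :=
    (hf.fderiv_right (m := 1) (by norm_num)).clm_apply contDiff_const
  have hf' : ContDiff ℝ 2 fun y => f (θ • y) := hf.comp (contDiff_const_smul θ)
  have hfc' : HasCompactSupport fun y => f (θ • y) :=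
    hfc.comp_homeomorph (Homeomorph.smulOfNeZero θ hθ)
  rw [← integral_dilation_generator_fderiv_mul μ hf' hfc' hw e, ← integral_const_mul]
  refine integral_congr_ae (Filter.Eventually.of_forall fun x => ?_)
  simp_rw [fderiv_comp_smul_apply (hf.differentiable two_ne_zero)]
  have h2 : fderiv ℝ (fun y => θ * fderiv ℝ f (θ • y) e) x x
      = θ * (θ * fderiv ℝ (fun y => fderiv ℝ f y e) (θ • x) x) := by
    rw [← fderiv_comp_smul_apply (hk.differentiable one_ne_zero), fderiv_const_mul]
    · simp
    · exact ((hk.comp (contDiff_const_smul θ)).differentiable one_ne_zero) x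
  rw [h2]
  simp only [map_smul, smul_eq_mul]
  ring

theorem integral_fderiv_comp_smul_mul (μ : Measure E) [μ.IsAddHaarMeasure]
    {f w : E → ℝ} (hf : ContDiff ℝ 1 f) (hfc : HasCompactSupport f) (hw : ContDiff ℝ 1 w)
    (e : E) {θ : ℝ} (hθ : θ ≠ 0) :
    θ * ∫ x, fderiv ℝ f (θ • x) e * w x ∂μ = - ∫ x, f (θ • x) * fderiv ℝ w x e ∂μ := by
  have hf' : ContDiff ℝ 1 fun y => f (θ • y) := hf.comp (contDiff_const_smul θ)
  have hfc' : HasCompactSupport fun y => f (θ • y) :=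
    hfc.comp_homeomorph (Homeomorph.smulOfNeZero θ hθ)
  rw [integral_mul_fderiv_eq_neg_of_contDiff μ hf' hfc' hw e, neg_neg, ← integral_const_mul]
  simp_rw [fderiv_comp_smul_apply (hf.differentiable one_ne_zero), mul_assoc]

theorem integrableOn_Ioc_deriv_comp_sub {v v' : ℝ → ℝ} (hv : ∀ τ, HasDerivAt v (v' τ) τ) {t : ℝ}
    (hfin : ∫⁻ σ in Set.Ioc 0 t, ‖v' (t - σ)‖ₑ ≠ ⊤) :
    IntegrableOn (fun σ => v' (t - σ)) (Set.Ioc 0 t) := by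
  have hm : Measurable v' := by
    rw [show v' = deriv v from funext fun τ => (hv τ).deriv.symm]
    exact measurable_deriv v
  exact ⟨(hm.comp (measurable_const.sub measurable_id)).aestronglyMeasurable,
    lt_top_iff_ne_top.2 hfin⟩

theorem enorm_comp_sub_le_setLIntegral_deriv {v v' : ℝ → ℝ} (hv : ∀ τ, HasDerivAt v (v' τ) τ)
    (hv0 : v 0 = 0) {t σ : ℝ} (hσ : σ ∈ Set.Icc 0 t) :
    ‖v (t - σ)‖ₑ ≤ ∫⁻ σ in Set.Ioc 0 t, ‖v' (t - σ)‖ₑ := by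
  by_cases hfin : ∫⁻ σ in Set.Ioc 0 t, ‖v' (t - σ)‖ₑ = ⊤
  · simp [hfin]
  have hi := integrableOn_Ioc_deriv_comp_sub hv hfin
  have hsub : Set.Ioc σ t ⊆ Set.Ioc 0 t := Set.Ioc_subset_Ioc_left hσ.1
  have hd : ∀ s ∈ Set.uIcc σ t, HasDerivAt (fun s => v (t - s)) (-v' (t - s)) s := fun s _ => by
    simpa using (hv (t - s)).comp_const_sub t s
  have h1 := intervalIntegral.integral_eq_sub_of_hasDerivAt hd
    ((intervalIntegrable_iff_integrableOn_Ioc_of_le hσ.2).2 (hi.mono_set hsub).neg)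
  have h2 : v (t - σ) = ∫ s in Set.Ioc σ t, v' (t - s) := by
    rw [intervalIntegral.integral_neg, intervalIntegral.integral_of_le hσ.2] at h1
    simp only [sub_self, hv0] at h1
    linarith
  rw [h2]
  exact (enorm_integral_le_lintegral_enorm _).trans (lintegral_mono_set hsub)

theorem setIntegral_deriv_mul_comp_sub {v v' κ κ' : ℝ → ℝ} (hv : ∀ τ, HasDerivAt v (v' τ) τ)
    (hv0 : v 0 = 0) {t : ℝ} (ht : 0 ≤ t) (hκ : ∀ σ ∈ Set.Icc 0 t, HasDerivAt κ (κ' σ) σ)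
    (hκ' : ContinuousOn κ' (Set.Icc 0 t)) (hfin : ∫⁻ σ in Set.Ioc 0 t, ‖v' (t - σ)‖ₑ ≠ ⊤) :
    ∫ σ in Set.Ioc 0 t, (κ' σ * v (t - σ) - κ σ * v' (t - σ)) = -(κ 0 * v t) := by
  have hvc : Continuous v := continuous_iff_continuousAt.2 fun τ => (hv τ).continuousAt
  have hu : Set.uIcc 0 t = Set.Icc 0 t := Set.uIcc_of_le ht
  have hd : ∀ s ∈ Set.uIcc 0 t, HasDerivAt (fun s => κ s * v (t - s))
      (κ' s * v (t - s) - κ s * v' (t - s)) s := fun s hs => by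
    have h := (hκ s (hu ▸ hs)).mul ((hv (t - s)).comp_const_sub t s)
    exact h.congr_deriv (by ring)
  have hκc : ContinuousOn κ (Set.uIcc 0 t) :=
    hu ▸ fun s hs => (hκ s hs).continuousAt.continuousWithinAt
  have hi : IntervalIntegrable (fun σ => κ' σ * v (t - σ) - κ σ * v' (t - σ)) volume 0 t := by
    refine IntervalIntegrable.sub ?_ ?_
    · refine ContinuousOn.intervalIntegrable ?_
      rw [hu]
      exact hκ'.mul (hvc.comp (continuous_const.sub continuous_id)).continuousOn
    · exact IntervalIntegrable.continuousOn_mul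
        ((intervalIntegrable_iff_integrableOn_Ioc_of_le ht).2
          (integrableOn_Ioc_deriv_comp_sub hv hfin)) hκc
  have h1 := intervalIntegral.integral_eq_sub_of_hasDerivAt hd hi
  rw [intervalIntegral.integral_of_le ht] at h1
  rw [h1]
  simp [hv0]

theorem enorm_integral_le_mul_setLIntegral {E : Type*} [MeasurableSpace E] {μ : Measure E}
    {S : Set E} (hS : MeasurableSet S)
    {h : E → ℝ} {g : E → ENNReal} {c : ENNReal} (hc : c ≠ ⊤) (h0 : ∀ z ∉ S, h z = 0)
    (hle : ∀ z ∈ S, ‖h z‖ₑ ≤ c * g z) : ‖∫ z, h z ∂μ‖ₑ ≤ c * ∫⁻ z in S, g z ∂μ := by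
  rw [← setIntegral_eq_integral_of_forall_compl_eq_zero h0, ← lintegral_const_mul' _ _ hc]
  exact (enorm_integral_le_lintegral_enorm _).trans (setLIntegral_mono' hS hle)

omit [FiniteDimensional ℝ E] [MeasurableSpace E] [BorelSpace E] in
theorem fderiv_eq_zero_of_forall_norm_gt {f : E → ℝ} {ρ : ℝ} (hf : ∀ y, ρ < ‖y‖ → f y = 0)
    {y : E} (hy : ρ < ‖y‖) : fderiv ℝ f y = 0 := by
  have : f =ᶠ[nhds y] fun _ => 0 := by
    filter_upwards [continuous_norm.continuousAt.eventually (lt_mem_nhds hy)] with z hz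
      using hf z hz
  rw [this.fderiv_eq, fderiv_const_apply]

theorem enorm_integral_comp_smul_mul_fderiv_le (μ : Measure E) [μ.IsAddHaarMeasure]
    {φ : E → ℝ} (hφ : ContDiff ℝ 2 φ) (hφ0 : ∀ y, 1 < ‖y‖ → φ y = 0) (e : E) {M : ℝ}
    (hM : ∀ y, |φ y| ≤ M) (hM' : ∀ y, |fderiv ℝ φ y e| ≤ M) {u ut : ℝ → E → ℝ}
    (hder : ∀ x τ, HasDerivAt (fun τ => u τ x) (ut τ x) τ) (hu : ∀ τ, ContDiff ℝ 2 (u τ))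
    (hu0 : ∀ x, u 0 x = 0) (hum : Measurable (Function.uncurry u))
    (hutm : Measurable (Function.uncurry ut)) {ε t : ℝ} (hε : 0 < ε) (ht : 0 ≤ t)
    (hloc : ∫⁻ σ in Set.Ioc 0 t, ∫⁻ z in Metric.closedBall 0 √(t + ε), ‖ut (t - σ) z‖ₑ ∂μ ≠ ⊤) :
    ‖∫ z, (√ε)⁻¹ ^ Module.finrank ℝ E * (φ ((√ε)⁻¹ • z) * fderiv ℝ (u t) z e) ∂μ‖ₑ
      ≤ ∫⁻ σ in Set.Ioc 0 t, ENNReal.ofReal (M * (√(σ + ε))⁻¹ ^ (Module.finrank ℝ E + 1)) *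
        ∫⁻ z in Metric.closedBall 0 √(σ + ε), (‖ut (t - σ) z‖ₑ
          + ‖fderiv ℝ (fun y => fderiv ℝ (u (t - σ)) y e) z‖ₑ) ∂μ := by
  set n := Module.finrank ℝ E with hn
  set θ : ℝ → ℝ := fun σ => (√(σ + ε))⁻¹ with hθdef
  set k : E → ℝ := fun y => fderiv ℝ φ y e with hkdef
  set G : E → ℝ := fun y => (n + 1) * k y + fderiv ℝ k y y with hGdef
  set B : Set E := Metric.closedBall 0 √(t + ε) with hBdef
  have hM0 : 0 ≤ M := (abs_nonneg _).trans (hM 0)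
  have hφc : HasCompactSupport φ := by
    refine HasCompactSupport.intro (isCompact_closedBall (0 : E) 1) fun x hx => hφ0 x ?_
    simpa using hx
  have hk : ContDiff ℝ 1 k := (hφ.fderiv_right (m := 1) (by norm_num)).clm_apply contDiff_const
  have hk0 : ∀ y, 1 < ‖y‖ → k y = 0 := fun y hy => by
    simp [hkdef, fderiv_eq_zero_of_forall_norm_gt hφ0 hy]
  have hGc : Continuous G := (continuous_const.mul hk.continuous).add
    ((hk.continuous_fderiv one_ne_zero).clm_apply continuous_id)
  have hG0 : ∀ y, 1 < ‖y‖ → G y = 0 := fun y hy => by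
    simp [hGdef, hk0 y hy, fderiv_eq_zero_of_forall_norm_gt hk0 hy]
  obtain ⟨MG, hMG⟩ := hGc.bounded_above_of_compact_support
    (HasCompactSupport.intro (isCompact_closedBall (0 : E) 1) fun x hx => hG0 x (by simpa using hx))
  have hMG0 : 0 ≤ MG := (norm_nonneg _).trans (hMG 0)
  have hθpos : ∀ σ, 0 ≤ σ → 0 < θ σ := fun σ hσ => inv_pos.2 (Real.sqrt_pos.2 (by linarith))
  have hθle : ∀ σ, 0 ≤ σ → θ σ ≤ θ 0 := fun σ hσ =>
    inv_anti₀ (Real.sqrt_pos.2 (by linarith)) (Real.sqrt_le_sqrt (by linarith))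
  have hball : ∀ σ, 0 ≤ σ → ∀ z ∉ Metric.closedBall (0 : E) √(σ + ε), 1 < ‖θ σ • z‖ := by
    intro σ hσ z hz
    have h1 : √(σ + ε) < ‖z‖ := by simpa using hz
    rw [norm_smul, Real.norm_of_nonneg (hθpos σ hσ).le, ← mul_inv_cancel₀ (hθpos σ hσ).ne']
    refine mul_lt_mul_of_pos_left ?_ (hθpos σ hσ)
    simpa [hθdef] using h1
  have hballB : ∀ σ ∈ Set.Icc 0 t, ∀ z ∉ B, 1 < ‖θ σ • z‖ := fun σ hσ z hz =>
    hball σ hσ.1 z fun hz' => hz (Metric.closedBall_subset_closedBall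
      (Real.sqrt_le_sqrt (by linarith [hσ.2])) hz')
  set κ : ℝ → E → ℝ := fun σ z => θ σ ^ (n + 1) * k (θ σ • z) with hκdef
  set κ' : ℝ → E → ℝ := fun σ z => θ σ ^ n * G (θ σ • z) * (-(1 / 2) * θ σ ^ 3) with hκ'def
  have hκder : ∀ z, ∀ σ ∈ Set.Icc 0 t, HasDerivAt (fun σ => κ σ z) (κ' σ z) σ := fun z σ hσ =>
    (hasDerivAt_pow_mul_comp_smul (hk.differentiable one_ne_zero) n (θ σ) z).comp σ
      (hasDerivAt_inv_sqrt_add (by linarith [hσ.1]))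
  have hθc : ContinuousOn θ (Set.Icc 0 t) := fun σ hσ =>
    (hasDerivAt_inv_sqrt_add (by linarith [hσ.1])).continuousAt.continuousWithinAt
  have hκ'c : ∀ z, ContinuousOn (fun σ => κ' σ z) (Set.Icc 0 t) := fun z =>
    ((hθc.pow n).mul (hGc.comp_continuousOn (hθc.smul continuousOn_const))).mul
      (continuousOn_const.mul (hθc.pow 3))
  have hθm : Measurable θ := (Real.continuous_sqrt.measurable.comp (measurable_id.add_const ε)).inv
  have hsm : Measurable fun a : ℝ × E => θ a.1 • a.2 :=
    (hθm.comp measurable_fst).smul measurable_snd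
  have hκm : Measurable fun a : ℝ × E => κ a.1 a.2 :=
    ((hθm.comp measurable_fst).pow_const _).mul (hk.continuous.measurable.comp hsm)
  have hκ'm : Measurable fun a : ℝ × E => κ' a.1 a.2 :=
    (((hθm.comp measurable_fst).pow_const _).mul (hGc.measurable.comp hsm)).mul
      (((hθm.comp measurable_fst).pow_const _).const_mul _)
  have hκb : ∀ σ, 0 ≤ σ → ∀ z, ‖κ σ z‖ ≤ θ 0 ^ (n + 1) * M := by
    intro σ hσ z
    rw [norm_mul, Real.norm_of_nonneg (pow_nonneg (hθpos σ hσ).le _)]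
    exact mul_le_mul (pow_le_pow_left₀ (hθpos σ hσ).le (hθle σ hσ) _) (hM' _) (norm_nonneg _)
      (pow_nonneg (hθpos 0 le_rfl).le _)
  have hκ'b : ∀ σ, 0 ≤ σ → ∀ z, ‖κ' σ z‖ ≤ θ 0 ^ n * MG * (1 / 2 * θ 0 ^ 3) := by
    intro σ hσ z
    have h0 := hθpos 0 le_rfl
    have h1 := hθpos σ hσ
    rw [norm_mul, norm_mul, norm_mul, Real.norm_of_nonneg (pow_nonneg h1.le _),
      Real.norm_of_nonneg (pow_nonneg h1.le 3), norm_neg,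
      Real.norm_of_nonneg (by norm_num : (0 : ℝ) ≤ 1 / 2)]
    gcongr
    · exact hθle σ hσ
    · exact hMG _
    · exact hθle σ hσ
  set P : Measure (ℝ × E) := (volume.restrict (Set.Ioc 0 t)).prod (μ.restrict B) with hP
  have hPae : ∀ᵐ a ∂P, 0 ≤ a.1 := by
    rw [hP, Measure.prod_restrict]
    exact ae_restrict_of_forall_mem (measurableSet_Ioc.prod measurableSet_closedBall)
      fun a ha => ha.1.1.le
  have hshift : Measurable fun a : ℝ × E => (t - a.1, a.2) :=
    (measurable_const.sub measurable_fst).prodMk measurable_snd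
  have hum' : Measurable fun a : ℝ × E => u (t - a.1) a.2 := hum.comp hshift
  have hutm' : Measurable fun a : ℝ × E => ut (t - a.1) a.2 := hutm.comp hshift
  have hUm : Measurable fun z => ∫⁻ σ in Set.Ioc 0 t, ‖ut (t - σ) z‖ₑ :=
    Measurable.lintegral_prod_left' hutm'.enorm
  have hUfin : ∫⁻ z in B, ∫⁻ σ in Set.Ioc 0 t, ‖ut (t - σ) z‖ₑ ∂volume ∂μ ≠ ⊤ := by
    rwa [← lintegral_lintegral_swap hutm'.enorm.aemeasurable]
  have hIut : Integrable (fun a : ℝ × E => ut (t - a.1) a.2) P := by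
    refine ⟨hutm'.aestronglyMeasurable, ?_⟩
    rw [HasFiniteIntegral, hP, lintegral_prod _ hutm'.enorm.aemeasurable]
    exact lt_top_iff_ne_top.2 hloc
  have hIu : Integrable (fun a : ℝ × E => u (t - a.1) a.2) P := by
    refine ⟨hum'.aestronglyMeasurable, ?_⟩
    rw [HasFiniteIntegral, hP, lintegral_prod _ hum'.enorm.aemeasurable]
    calc _ ≤ ∫⁻ σ in Set.Ioc 0 t, ∫⁻ z in B, ∫⁻ σ in Set.Ioc 0 t, ‖ut (t - σ) z‖ₑ ∂volume ∂μ :=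
          setLIntegral_mono' measurableSet_Ioc fun σ hσ => lintegral_mono fun z =>
            enorm_comp_sub_le_setLIntegral_deriv (hder z) (hu0 z) ⟨hσ.1.le, hσ.2⟩
      _ < ⊤ := by
          rw [setLIntegral_const]
          exact ENNReal.mul_lt_top (lt_top_iff_ne_top.2 hUfin) measure_Ioc_lt_top
  have hIA : Integrable (fun a : ℝ × E => κ' a.1 a.2 * u (t - a.1) a.2) P :=
    hIu.bdd_mul hκ'm.aestronglyMeasurable (hPae.mono fun a ha => hκ'b a.1 ha a.2)
  have hIB : Integrable (fun a : ℝ × E => κ a.1 a.2 * ut (t - a.1) a.2) P :=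
    hIut.bdd_mul hκm.aestronglyMeasurable (hPae.mono fun a ha => hκb a.1 ha a.2)
  have hI := hIA.sub hIB
  have hftc : ∀ᵐ z ∂μ.restrict B, ∫ σ in Set.Ioc 0 t,
      (κ' σ z * u (t - σ) z - κ σ z * ut (t - σ) z) = -(κ 0 z * u t z) := by
    filter_upwards [ae_lt_top hUm hUfin] with z hz
    exact setIntegral_deriv_mul_comp_sub (hder z) (hu0 z) ht (hκder z) (hκ'c z) hz.ne
  have hswap : ∫ σ in Set.Ioc 0 t, ∫ z in B, (κ' σ z * u (t - σ) z - κ σ z * ut (t - σ) z) ∂μ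
      = -∫ z in B, κ 0 z * u t z ∂μ := by
    rw [integral_integral_swap hI, integral_congr_ae hftc, integral_neg]
  have hκ0 : ∫ z in B, κ 0 z * u t z ∂μ = ∫ z, κ 0 z * u t z ∂μ :=
    setIntegral_eq_integral_of_forall_compl_eq_zero fun z hz => by
      simp [hκdef, hk0 _ (hballB 0 ⟨le_rfl, ht⟩ z hz)]
  have hlhs : ∫ z, (√ε)⁻¹ ^ n * (φ ((√ε)⁻¹ • z) * fderiv ℝ (u t) z e) ∂μ
      = -∫ z, κ 0 z * u t z ∂μ := by
    have hθ0 : (√ε)⁻¹ = θ 0 := by simp [hθdef]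
    have h1 := integral_fderiv_comp_smul_mul μ (hφ.of_le (by norm_num)) hφc
      ((hu t).of_le (by norm_num)) e (hθpos 0 le_rfl).ne'
    have h2 : ∀ z, κ 0 z * u t z = θ 0 ^ n * (θ 0 * (k (θ 0 • z) * u t z)) := fun z => by
      simp only [hκdef]; ring
    simp_rw [h2]
    rw [hθ0, integral_const_mul, integral_const_mul, integral_const_mul, h1]
    ring
  rw [hlhs, ← hκ0, ← hswap]
  refine (enorm_integral_le_lintegral_enorm _).trans (lintegral_mono_ae ?_)
  filter_upwards [hIA.prod_right_ae, hIB.prod_right_ae, ae_restrict_mem measurableSet_Ioc]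
    with σ hA hB hσ
  have hσ0 : 0 ≤ σ := hσ.1.le
  have hutσ : Measurable fun z => ‖ut (t - σ) z‖ₑ := (hutm.comp measurable_prodMk_left).enorm
  have hθσ := hθpos σ hσ0
  rw [integral_sub hA hB, lintegral_add_left hutσ, mul_add]
  have hc : 0 ≤ M * θ σ ^ (n + 1) := mul_nonneg hM0 (pow_nonneg hθσ.le _)
  refine enorm_sub_le.trans ?_
  rw [add_comm]
  refine add_le_add ?_ ?_
  · rw [setIntegral_eq_integral_of_forall_compl_eq_zero fun z hz => by
      simp [hκdef, hk0 _ (hballB σ ⟨hσ0, hσ.2⟩ z hz)]]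
    refine enorm_integral_le_mul_setLIntegral measurableSet_closedBall ENNReal.ofReal_ne_top
      (fun z hz => by simp [hκdef, hk0 _ (hball σ hσ0 z hz)]) fun z _ => ?_
    rw [enorm_mul]
    gcongr
    rw [Real.enorm_eq_ofReal_abs]
    refine ENNReal.ofReal_le_ofReal ?_
    rw [abs_mul, abs_of_nonneg (pow_nonneg hθσ.le _), mul_comm]
    exact mul_le_mul_of_nonneg_right (hM' _) (pow_nonneg hθσ.le _)
  · rw [setIntegral_eq_integral_of_forall_compl_eq_zero fun z hz => by
      simp [hκ'def, hG0 _ (hballB σ ⟨hσ0, hσ.2⟩ z hz)]]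
    have h1 := integral_dilation_generator_comp_smul_mul μ hφ hφc (hu (t - σ)) e hθσ.ne'
    have h2 : ∀ z, κ' σ z * u (t - σ) z
        = -(1 / 2) * θ σ ^ (n + 2) * (θ σ * (G (θ σ • z) * u (t - σ) z)) := fun z => by
      simp only [hκ'def]; ring
    simp_rw [h2]
    rw [integral_const_mul, integral_const_mul]
    simp only [hGdef, hkdef, hn]
    rw [h1, ← integral_const_mul]
    refine enorm_integral_le_mul_setLIntegral measurableSet_closedBall ENNReal.ofReal_ne_top
      (fun z hz => by simp [hφ0 _ (hball σ hσ0 z hz)]) fun z hz => ?_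
    rw [← ofReal_norm, ← ofReal_norm, ← ENNReal.ofReal_mul hc]
    refine ENNReal.ofReal_le_ofReal ?_
    have hz' : ‖z‖ ≤ (θ σ)⁻¹ := by simpa [hθdef] using hz
    have h3 := (fderiv ℝ (fun y => fderiv ℝ (u (t - σ)) y e) z).le_opNorm z
    rw [norm_mul, norm_mul, norm_mul, norm_neg, Real.norm_of_nonneg (pow_nonneg hθσ.le _),
      Real.norm_of_nonneg (by norm_num : (0 : ℝ) ≤ 1 / 2)]
    calc _ ≤ 1 / 2 * θ σ ^ (n + 2)
          * (M * (‖fderiv ℝ (fun y => fderiv ℝ (u (t - σ)) y e) z‖ * (θ σ)⁻¹)) := by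
          gcongr
          · exact hM _
          · exact h3.trans (by gcongr)
      _ = 1 / 2 * (M * θ σ ^ (n + 1) * ‖fderiv ℝ (fun y => fderiv ℝ (u (t - σ)) y e) z‖) := by
          field_simp
          ring
      _ ≤ _ := by
          have := mul_nonneg hc (norm_nonneg (fderiv ℝ (fun y => fderiv ℝ (u (t - σ)) y e) z))
          linarith

omit [MeasurableSpace E] [BorelSpace E] [FiniteDimensional ℝ E] in
theorem HasFDerivAt.comp_const_sub_left {F : Type*} [NormedAddCommGroup F] [NormedSpace ℝ F]
    {f : E → F} {x z : E} {f' : E →L[ℝ] F} (hf : HasFDerivAt f f' (x - z)) :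
    HasFDerivAt (fun z => f (x - z)) (-f') z := by
  refine (hf.comp z ((hasFDerivAt_id z).const_sub x)).congr_fderiv ?_
  ext v
  simp

theorem enorm_integral_comp_smul_mul_fderiv_sub_le (μ : Measure E) [μ.IsAddHaarMeasure]
    {φ : E → ℝ} (hφ : ContDiff ℝ 2 φ) (hφ0 : ∀ y, 1 < ‖y‖ → φ y = 0) {M : ℝ}
    (hM : ∀ y, |φ y| ≤ M) (hM' : ∀ y, ‖fderiv ℝ φ y‖ ≤ M) {e : E} (he : ‖e‖ ≤ 1)
    {u ut : ℝ → E → ℝ} (hder : ∀ x τ, HasDerivAt (fun τ => u τ x) (ut τ x) τ)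
    (hu : ∀ τ, ContDiff ℝ 2 (u τ)) (hu0 : ∀ x, u 0 x = 0) (hum : Measurable (Function.uncurry u))
    (hutm : Measurable (Function.uncurry ut)) {ε t : ℝ} (hε : 0 < ε) (ht : 0 ≤ t) (x : E)
    (hloc : ∫⁻ σ in Set.Ioc 0 t, ∫⁻ z in Metric.closedBall 0 √(t + ε),
      ‖ut (t - σ) (x - z)‖ₑ ∂μ ≠ ⊤) :
    ‖∫ z, (√ε)⁻¹ ^ Module.finrank ℝ E * (φ ((√ε)⁻¹ • z) * fderiv ℝ (u t) (x - z) e) ∂μ‖ₑ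
      ≤ ∫⁻ σ in Set.Ioc 0 t, ENNReal.ofReal (M * (√(σ + ε))⁻¹ ^ (Module.finrank ℝ E + 1)) *
        ∫⁻ z in Metric.closedBall 0 √(σ + ε), (‖ut (t - σ) (x - z)‖ₑ
          + ‖fderiv ℝ (fderiv ℝ (u (t - σ))) (x - z)‖ₑ) ∂μ := by
  have hM'' : ∀ y, |fderiv ℝ φ y e| ≤ M := fun y =>
    ((fderiv ℝ φ y).le_opNorm_of_le he).trans (by simpa using hM' y)
  have hfst : ∀ τ z, fderiv ℝ (fun z => u τ (x - z)) z = -fderiv ℝ (u τ) (x - z) := fun τ z =>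
    (((hu τ).differentiable two_ne_zero _).hasFDerivAt.comp_const_sub_left).fderiv
  have hshift : Measurable fun a : ℝ × E => (a.1, x - a.2) :=
    measurable_fst.prodMk (measurable_const.sub measurable_snd)
  have h := enorm_integral_comp_smul_mul_fderiv_le μ hφ hφ0 e hM hM''
    (u := fun τ z => u τ (x - z)) (ut := fun τ z => ut τ (x - z)) (fun z τ => hder _ τ)
    (fun τ => (hu τ).comp (contDiff_const.sub contDiff_id)) (fun z => hu0 _)
    (hum.comp hshift) (hutm.comp hshift) hε ht hloc
  simp_rw [hfst] at h
  simp only [_root_.neg_apply, mul_neg, integral_neg, enorm_neg] at h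
  refine h.trans (lintegral_mono fun σ => ?_)
  dsimp only
  gcongr with z
  have hD : ContDiff ℝ 1 (fderiv ℝ (u (t - σ))) := (hu _).fderiv_right (by norm_num)
  have h2 := (((hD.differentiable one_ne_zero (x - z)).hasFDerivAt.clm_apply
    (hasFDerivAt_const e _)).comp_const_sub_left).neg
  have h2' : HasFDerivAt (fun y => -(fderiv ℝ (u (t - σ)) (x - y)) e) _ z := h2
  rw [h2'.fderiv, ← ofReal_norm, ← ofReal_norm]
  refine ENNReal.ofReal_le_ofReal
    (ContinuousLinearMap.opNorm_le_bound _ (norm_nonneg _) fun v => ?_)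
  have h3 := (fderiv ℝ (fderiv ℝ (u (t - σ))) (x - z) v).le_opNorm_of_le he
  have h4 := (fderiv ℝ (fderiv ℝ (u (t - σ))) (x - z)).le_opNorm v
  simp
  simp at h3
  exact h3.trans h4

theorem tendsto_integral_comp_smul_mul_sub (μ : Measure E) [μ.IsAddHaarMeasure]
    {φ h : E → ℝ} (hφ : Continuous φ) (hφ0 : ∀ y, 1 < ‖y‖ → φ y = 0) (hφ1 : ∫ y, φ y ∂μ = 1)
    (hh : Continuous h) (x : E) {ε : ℕ → ℝ} (hε : ∀ m, 0 < ε m)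
    (hε0 : Filter.Tendsto ε Filter.atTop (nhds 0)) :
    Filter.Tendsto (fun m => ∫ z, (√(ε m))⁻¹ ^ Module.finrank ℝ E *
      (φ ((√(ε m))⁻¹ • z) * h (x - z)) ∂μ) Filter.atTop (nhds (h x)) := by
  have hc : Continuous fun η : ℝ => ∫ y in Metric.closedBall (0 : E) 1, φ y * h (x - η • y) ∂μ := by
    refine continuous_parametric_integral_of_continuous ?_ (isCompact_closedBall 0 1)
    exact (hφ.comp continuous_snd).mul
      (hh.comp (continuous_const.sub (continuous_fst.smul continuous_snd)))
  have hball : ∀ η : ℝ, ∫ y in Metric.closedBall (0 : E) 1, φ y * h (x - η • y) ∂μ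
      = ∫ y, φ y * h (x - η • y) ∂μ := fun η =>
    setIntegral_eq_integral_of_forall_compl_eq_zero fun z hz => by
      rw [hφ0 z (by simpa using hz), zero_mul]
  have h0 : ∫ y in Metric.closedBall (0 : E) 1, φ y * h (x - (0 : ℝ) • y) ∂μ = h x := by
    rw [hball]
    simp [integral_mul_const, hφ1]
  have hlim := (hc.tendsto 0).comp ((Real.continuous_sqrt.tendsto' 0 0 Real.sqrt_zero).comp hε0)
  rw [h0] at hlim
  refine hlim.congr fun m => ?_
  have hη : 0 < √(ε m) := Real.sqrt_pos.2 (hε m)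
  have hcv := Measure.integral_comp_smul μ (fun y => φ y * h (x - √(ε m) • y)) (√(ε m))⁻¹
  simp_rw [smul_inv_smul₀ hη.ne'] at hcv
  simp only [Function.comp]
  rw [hball, integral_const_mul, hcv, abs_of_pos (by positivity), smul_eq_mul,
    mul_inv_cancel_left₀ (by positivity)]

theorem measurable_fderiv_uncurry {α F : Type*} [MeasurableSpace α] [NormedAddCommGroup F]
    [NormedSpace ℝ F] [MeasurableSpace F] [BorelSpace F] [SecondCountableTopology F]
    {h : α → E → F} (hh : Measurable (Function.uncurry h)) (hd : ∀ a, Differentiable ℝ (h a)) :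
    Measurable fun x : α × E => fderiv ℝ (h x.1) x.2 := by
  classical
  have happ : ∀ v, Measurable fun x : α × E => fderiv ℝ (h x.1) x.2 v := by
    intro v
    refine measurable_of_tendsto_metrizable
      (f := fun (m : ℕ) (x : α × E) => (m : ℝ) • (h x.1 (x.2 + (m : ℝ)⁻¹ • v) - h x.1 x.2))
      (fun m => ?_) ?_
    · exact ((hh.comp (measurable_fst.prodMk (measurable_snd.add_const _))).sub hh).const_smul _
    · exact tendsto_pi_nhds.2 fun x =>
        ((hd x.1 x.2).hasFDerivAt.lim_real v).comp tendsto_natCast_atTop_atTop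
  set b := Module.finBasis ℝ E
  let c : Fin (Module.finrank ℝ E) → (E →L[ℝ] ℝ) := fun i => (b.coord i).toContinuousLinearMap
  let Ψ : (Fin (Module.finrank ℝ E) → F) → (E →L[ℝ] F) := fun w =>
    ∑ i, ContinuousLinearMap.smulRightL ℝ E F (c i) (w i)
  have hΨ : Continuous Ψ := continuous_finsetSum _ fun i _ =>
    (ContinuousLinearMap.smulRightL ℝ E F (c i)).continuous.comp (continuous_apply i)
  have heq : (fun x : α × E => fderiv ℝ (h x.1) x.2)
      = fun x => Ψ fun i => fderiv ℝ (h x.1) x.2 (b i) := by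
    funext x
    ext v
    conv_lhs => rw [← b.sum_repr v, map_sum]
    simp [Ψ, c]
  rw [heq]
  exact hΨ.measurable.comp (measurable_pi_iff.2 fun i => happ (b i))

omit [FiniteDimensional ℝ E] [NormedSpace ℝ E] in
theorem setLIntegral_sub_le_mul_rpow [SecondCountableTopology E] (μ : Measure E)
    [μ.IsAddLeftInvariant] [μ.IsNegInvariant] {p : ℝ} (hp : 1 < p) {g : E → ENNReal}
    (hg : Measurable g) (B : Set E) (x : E) :
    ∫⁻ z in B, g (x - z) ∂μ ≤ (∫⁻ y, g y ^ p ∂μ) ^ (1 / p) * μ B ^ (1 - 1 / p) := by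
  have hpq : p.HolderConjugate (p / (p - 1)) := Real.HolderConjugate.conjExponent hp
  have h := ENNReal.lintegral_mul_le_Lp_mul_Lq (μ.restrict B) hpq
    (f := fun z => g (x - z)) (g := fun _ => 1)
    (hg.comp (measurable_const.sub measurable_id)).aemeasurable aemeasurable_const
  simp only [Pi.mul_apply, mul_one, ENNReal.one_rpow, lintegral_const, Measure.restrict_apply_univ,
    one_mul] at h
  rw [show 1 / (p / (p - 1)) = 1 - 1 / p by field_simp] at h
  refine h.trans (mul_le_mul_left (ENNReal.rpow_le_rpow ?_ (by positivity)) _)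
  exact (setLIntegral_le_lintegral _ _).trans_eq
    (lintegral_sub_left_eq_self (fun y => g y ^ p) x)

theorem measurable_setLIntegral_closedBall_sub (μ : Measure E) [SFinite μ] {g : ℝ → E → ENNReal}
    (hg : Measurable (Function.uncurry g)) {ρ : ℝ → ℝ} (hρ : Measurable ρ) (t : ℝ) :
    Measurable fun a : E × ℝ => ∫⁻ z in Metric.closedBall 0 (ρ a.2), g (t - a.2) (a.1 - z) ∂μ := by
  have hS : MeasurableSet {b : (E × ℝ) × E | ‖b.2‖ ≤ ρ b.1.2} :=
    measurableSet_le measurable_snd.norm (hρ.comp (measurable_snd.comp measurable_fst))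
  have hm : Measurable fun b : (E × ℝ) × E => g (t - b.1.2) (b.1.1 - b.2) :=
    hg.comp ((measurable_const.sub (measurable_snd.comp measurable_fst)).prodMk
      ((measurable_fst.comp measurable_fst).sub measurable_snd))
  convert Measurable.lintegral_prod_right' (ν := μ) (hm.indicator hS) using 2 with a
  rw [← lintegral_indicator measurableSet_closedBall]
  refine lintegral_congr fun z => ?_
  simp [Set.indicator]

omit [FiniteDimensional ℝ E] [MeasurableSpace E] [BorelSpace E] in
theorem enorm_le_of_forall_enorm_apply_le {L : E →L[ℝ] ℝ} {c : ENNReal}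
    (h : ∀ e : E, ‖e‖ ≤ 1 → ‖L e‖ₑ ≤ c) : ‖L‖ₑ ≤ c := by
  by_cases hc : c = ⊤
  · simp [hc]
  rw [← ofReal_norm]
  refine ENNReal.ofReal_le_of_le_toReal ?_
  refine ContinuousLinearMap.opNorm_le_of_unit_norm ENNReal.toReal_nonneg fun e he => ?_
  rw [← toReal_enorm]
  exact ENNReal.toReal_mono hc (h e he.le)

theorem enorm_fderiv_le_liminf (μ : Measure E) [μ.IsAddHaarMeasure]
    {φ : E → ℝ} (hφ : ContDiff ℝ 2 φ) (hφ0 : ∀ y, 1 < ‖y‖ → φ y = 0) (hφ1 : ∫ y, φ y ∂μ = 1)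
    {M : ℝ} (hM : ∀ y, |φ y| ≤ M) (hM' : ∀ y, ‖fderiv ℝ φ y‖ ≤ M)
    {u ut : ℝ → E → ℝ} (hder : ∀ x τ, HasDerivAt (fun τ => u τ x) (ut τ x) τ)
    (hu : ∀ τ, ContDiff ℝ 2 (u τ)) (hu0 : ∀ x, u 0 x = 0) (hum : Measurable (Function.uncurry u))
    (hutm : Measurable (Function.uncurry ut)) {t : ℝ} (ht : 0 ≤ t) (x : E)
    (hloc : ∀ ρ : ℝ, ∫⁻ σ in Set.Ioc 0 t, ∫⁻ z in Metric.closedBall 0 ρ,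
      ‖ut (t - σ) (x - z)‖ₑ ∂μ ≠ ⊤) {ε : ℕ → ℝ} (hε : ∀ m, 0 < ε m)
    (hε0 : Filter.Tendsto ε Filter.atTop (nhds 0)) :
    ‖fderiv ℝ (u t) x‖ₑ ≤ Filter.liminf (fun m => ∫⁻ σ in Set.Ioc 0 t,
        ENNReal.ofReal (M * (√(σ + ε m))⁻¹ ^ (Module.finrank ℝ E + 1)) *
        ∫⁻ z in Metric.closedBall 0 √(σ + ε m), (‖ut (t - σ) (x - z)‖ₑ
          + ‖fderiv ℝ (fderiv ℝ (u (t - σ))) (x - z)‖ₑ) ∂μ) Filter.atTop := by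
  refine enorm_le_of_forall_enorm_apply_le fun e he => ?_
  have hc : Continuous fun y => fderiv ℝ (u t) y e :=
    ((hu t).continuous_fderiv two_ne_zero).clm_apply continuous_const
  have hlim := (tendsto_integral_comp_smul_mul_sub μ hφ.continuous hφ0 hφ1 hc x hε hε0).enorm
  rw [← hlim.liminf_eq]
  exact Filter.liminf_le_liminf (Filter.Eventually.of_forall fun m =>
    enorm_integral_comp_smul_mul_fderiv_sub_le μ hφ hφ0 hM hM' he hder hu hu0 hum hutm (hε m) ht x
      (hloc _))

/-- Fixed-time gradient bound: the spatial `L^r` norm of `∇u(t)` is controlled by a Riesz potential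
in time of the spatial `L^p` norms of `∂_t u` and `∇²u`. -/
theorem lintegral_enorm_fderiv_rpow_le (μ : Measure E) [μ.IsAddHaarMeasure] [μ.IsNegInvariant]
    {φ : E → ℝ} (hφ : ContDiff ℝ 2 φ) (hφ0 : ∀ y, 1 < ‖y‖ → φ y = 0) (hφ1 : ∫ y, φ y ∂μ = 1)
    {M : ℝ} (hM : ∀ y, |φ y| ≤ M) (hM' : ∀ y, ‖fderiv ℝ φ y‖ ≤ M)
    {p r : ℝ} (hp : 1 < p) (hpr : p < r)
    {u ut : ℝ → E → ℝ} (hder : ∀ x τ, HasDerivAt (fun τ => u τ x) (ut τ x) τ)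
    (hu : ∀ τ, ContDiff ℝ 2 (u τ)) (hu0 : ∀ x, u 0 x = 0) (hum : Measurable (Function.uncurry u))
    (hutm : Measurable (Function.uncurry ut))
    (hD2m : Measurable fun a : ℝ × E => ‖fderiv ℝ (fderiv ℝ (u a.1)) a.2‖ₑ) {t : ℝ} (ht : 0 ≤ t)
    {N : ℝ → ENNReal} (hN : ∀ τ ∈ Set.Icc 0 t, (∫⁻ y, (‖ut τ y‖ₑ
      + ‖fderiv ℝ (fderiv ℝ (u τ)) y‖ₑ) ^ p ∂μ) ^ (1 / p) ≤ N τ)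
    (hNfin : ∫⁻ σ in Set.Ioc 0 t, N (t - σ) ≠ ⊤) :
    (∫⁻ x, ‖fderiv ℝ (u t) x‖ₑ ^ r ∂μ) ^ (1 / r)
      ≤ ENNReal.ofReal M * μ (Metric.ball 0 1) ^ (1 - 1 / p + 1 / r) *
        ∫⁻ σ in Set.Ioc 0 t, ENNReal.ofReal
          (σ ^ (-(1 / 2) - (Module.finrank ℝ E : ℝ) / 2 * (1 / p - 1 / r))) * N (t - σ) := by
  set n := Module.finrank ℝ E with hn
  set g : ℝ → E → ENNReal := fun τ y => ‖ut τ y‖ₑ + ‖fderiv ℝ (fderiv ℝ (u τ)) y‖ₑ with hgdef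
  set V := μ (Metric.ball (0 : E) 1) with hV
  have hVtop : V ≠ ⊤ := measure_ball_lt_top.ne
  have hM0 : 0 ≤ M := (abs_nonneg _).trans (hM 0)
  have hr0 : 0 < r := by linarith
  have hrp : 1 / r < 1 / p := one_div_lt_one_div_of_lt (by linarith) hpr
  have hp1 : 1 / p < 1 := by rw [div_lt_one (by linarith)]; exact hp
  have hr1 : 0 < 1 / r := by positivity
  have hγ : 0 < 1 - 1 / p + 1 / r := by linarith
  have hgm : Measurable (Function.uncurry g) := hutm.enorm.add hD2m
  have hgτ : ∀ τ, Measurable (g τ) := fun τ => hgm.comp measurable_prodMk_left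
  have hloc : ∀ x (ρ : ℝ), ∫⁻ σ in Set.Ioc 0 t, ∫⁻ z in Metric.closedBall 0 ρ,
      ‖ut (t - σ) (x - z)‖ₑ ∂μ ≠ ⊤ := by
    intro x ρ
    have hfin : μ (Metric.closedBall (0 : E) ρ) ^ (1 - 1 / p) ≠ ⊤ :=
      ENNReal.rpow_ne_top_of_nonneg (by linarith) measure_closedBall_lt_top.ne
    refine ((setLIntegral_mono' measurableSet_Ioc fun σ hσ => ?_).trans_lt
      (b := ∫⁻ σ in Set.Ioc 0 t, N (t - σ) * μ (Metric.closedBall (0 : E) ρ) ^ (1 - 1 / p)) ?_).ne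
    · have hτ : t - σ ∈ Set.Icc 0 t := ⟨by linarith [hσ.2], by linarith [hσ.1]⟩
      refine (setLIntegral_sub_le_mul_rpow μ hp
        (hutm.comp (measurable_prodMk_left (x := t - σ))).enorm _ x).trans ?_
      gcongr
      refine (ENNReal.rpow_le_rpow (lintegral_mono fun y => ?_) (by positivity)).trans (hN _ hτ)
      exact ENNReal.rpow_le_rpow le_self_add (by linarith)
    · rw [lintegral_mul_const' _ _ hfin]
      exact lt_top_iff_ne_top.2 (ENNReal.mul_ne_top hNfin hfin)
  set ε : ℕ → ℝ := fun m => 1 / ((m : ℝ) + 1) with hεdef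
  have hε : ∀ m, 0 < ε m := fun m => Nat.one_div_pos_of_nat
  have hε0 : Filter.Tendsto ε Filter.atTop (nhds 0) := tendsto_one_div_add_atTop_nhds_zero_nat
  set a : ℕ → ℝ → ENNReal := fun m σ => ENNReal.ofReal (M * (√(σ + ε m))⁻¹ ^ (n + 1)) with hadef
  set A : ℕ → E → ℝ → ENNReal := fun m x σ =>
    ∫⁻ z in Metric.closedBall 0 √(σ + ε m), g (t - σ) (x - z) ∂μ with hAdef
  have hsq : ∀ m, Measurable fun σ : ℝ => √(σ + ε m) := fun m =>
    Real.continuous_sqrt.measurable.comp (measurable_id.add_const _)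
  have ham : ∀ m, Measurable (a m) := fun m =>
    (((hsq m).inv.pow_const _).const_mul _).ennreal_ofReal
  have hAm : ∀ m, Measurable (Function.uncurry fun x σ => a m σ * A m x σ) := fun m =>
    ((ham m).comp measurable_snd).mul (measurable_setLIntegral_closedBall_sub μ hgm (hsq m) t)
  have hFm : ∀ m, Measurable fun x => (∫⁻ σ in Set.Ioc 0 t, a m σ * A m x σ) ^ r := fun m =>
    (Measurable.lintegral_prod_right' (hAm m)).pow_const r
  have hpt : ∀ x, ‖fderiv ℝ (u t) x‖ₑ ^ r
      ≤ Filter.liminf (fun m => (∫⁻ σ in Set.Ioc 0 t, a m σ * A m x σ) ^ r) Filter.atTop := by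
    intro x
    refine (ENNReal.rpow_le_rpow (enorm_fderiv_le_liminf μ hφ hφ0 hφ1 hM hM' hder hu hu0 hum hutm
      ht x (hloc x) hε hε0) hr0.le).trans_eq ?_
    exact (ENNReal.orderIsoRpow r hr0).liminf_apply
  set I := ∫⁻ σ in Set.Ioc 0 t, ENNReal.ofReal
    (σ ^ (-(1 / 2) - (n : ℝ) / 2 * (1 / p - 1 / r))) * N (t - σ) with hI
  have hm : ∀ m, ∫⁻ x, (∫⁻ σ in Set.Ioc 0 t, a m σ * A m x σ) ^ r ∂μ
      ≤ (ENNReal.ofReal M * V ^ (1 - 1 / p + 1 / r) * I) ^ r := by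
    intro m
    set b : ℝ → ENNReal := fun σ => a m σ * (μ (Metric.closedBall (0 : E) √(σ + ε m))
      ^ (1 - 1 / p + 1 / r) * (∫⁻ y, g (t - σ) y ^ p ∂μ) ^ (1 / p)) with hbdef
    have hbm : Measurable b := by
      refine (ham m).mul (Measurable.mul ?_ ?_)
      · simp_rw [Measure.addHaar_closedBall μ _ (Real.sqrt_nonneg _)]
        exact ((((hsq m).pow_const _).ennreal_ofReal).mul_const _).pow_const _
      · refine Measurable.pow_const (Measurable.lintegral_prod_right' (ν := μ)
          (f := fun c : ℝ × E => g (t - c.1) c.2 ^ p) ?_) _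
        exact (hgm.comp ((measurable_const.sub measurable_fst).prodMk measurable_snd)).pow_const p
    refine (lintegral_lintegral_rpow_le (μ := μ) (ν := volume.restrict (Set.Ioc 0 t))
      (by linarith) (hAm m) hbm fun σ => ?_).trans (ENNReal.rpow_le_rpow ?_ hr0.le)
    · simp_rw [ENNReal.mul_rpow_of_nonneg _ _ hr0.le, hbdef]
      rw [lintegral_const_mul' _ _ (ENNReal.rpow_ne_top_of_nonneg hr0.le ENNReal.ofReal_ne_top),
        ENNReal.mul_rpow_of_nonneg _ _ hr0.le]
      gcongr
      exact lintegral_setLIntegral_sub_rpow_le μ hp hpr (hgτ _) _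
    · rw [hI, ← lintegral_const_mul' _ _ (ENNReal.mul_ne_top ENNReal.ofReal_ne_top
        (ENNReal.rpow_ne_top_of_nonneg hγ.le hVtop))]
      refine setLIntegral_mono' measurableSet_Ioc fun σ hσ => ?_
      have hτ : t - σ ∈ Set.Icc 0 t := ⟨by linarith [hσ.2], by linarith [hσ.1]⟩
      simp only [hbdef, hadef]
      rw [Measure.addHaar_closedBall μ _ (Real.sqrt_nonneg _), ENNReal.mul_rpow_of_nonneg _ _ hγ.le,
        ENNReal.ofReal_rpow_of_nonneg (by positivity) hγ.le, ENNReal.ofReal_mul hM0]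
      calc _ = ENNReal.ofReal M * V ^ (1 - 1 / p + 1 / r) *
            (ENNReal.ofReal ((√(σ + ε m))⁻¹ ^ (n + 1)) * ENNReal.ofReal
              ((√(σ + ε m) ^ n) ^ (1 - 1 / p + 1 / r)) * (∫⁻ y, g (t - σ) y ^ p ∂μ) ^ (1 / p)) := by
            ring
        _ ≤ _ := by
            rw [← ENNReal.ofReal_mul (by positivity)]
            gcongr
            · exact inv_sqrt_add_pow_mul_rpow_le hσ.1 (hε m).le hrp.le n
            · exact hN _ hτ
  calc (∫⁻ x, ‖fderiv ℝ (u t) x‖ₑ ^ r ∂μ) ^ (1 / r)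
      ≤ ((ENNReal.ofReal M * V ^ (1 - 1 / p + 1 / r) * I) ^ r) ^ (1 / r) := by
        refine ENNReal.rpow_le_rpow ?_ (by positivity)
        refine (lintegral_mono hpt).trans ((lintegral_liminf_le hFm).trans ?_)
        exact (Filter.liminf_le_liminf (Filter.Eventually.of_forall hm)).trans_eq
          (Filter.liminf_const _)
    _ = _ := by rw [← ENNReal.rpow_mul, mul_one_div_cancel hr0.ne', ENNReal.rpow_one]

omit [FiniteDimensional ℝ E] [NormedSpace ℝ E] [BorelSpace E] in
theorem measurable_uncurry_of_hasDerivAt [SecondCountableTopology E] {u ut : ℝ → E → ℝ}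
    (hder : ∀ x τ, HasDerivAt (fun τ => u τ x) (ut τ x) τ) (hum : Measurable (Function.uncurry u)) :
    Measurable (Function.uncurry ut) := by
  refine measurable_of_tendsto_metrizable (f := fun (m : ℕ) (a : ℝ × E) =>
    (m : ℝ) * (u (a.1 + (m : ℝ)⁻¹) a.2 - u a.1 a.2)) (fun m => ?_) ?_
  · exact ((hum.comp ((measurable_fst.add_const _).prodMk measurable_snd)).sub hum).const_mul _
  · refine tendsto_pi_nhds.2 fun a => ?_
    have h := ((hder a.2 a.1).hasFDerivAt.lim_real 1).comp tendsto_natCast_atTop_atTop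
    simpa [Function.comp_def, Function.uncurry] using h

theorem exists_contDiff_bump (μ : Measure E) [μ.IsAddHaarMeasure] [HasContDiffBump E] :
    ∃ (φ : E → ℝ) (M : ℝ), ContDiff ℝ 2 φ ∧ (∀ y, 1 < ‖y‖ → φ y = 0) ∧ ∫ y, φ y ∂μ = 1 ∧
      (∀ y, |φ y| ≤ M) ∧ ∀ y, ‖fderiv ℝ φ y‖ ≤ M := by
  let f : ContDiffBump (0 : E) := ⟨1 / 2, 1, by norm_num, by norm_num⟩
  have hφ : ContDiff ℝ 2 (f.normed μ) := f.contDiff_normed (n := 2)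
  have hc : HasCompactSupport (f.normed μ) := f.hasCompactSupport_normed
  obtain ⟨M₁, h₁⟩ := hφ.continuous.bounded_above_of_compact_support hc
  obtain ⟨M₂, h₂⟩ :=
    (hφ.continuous_fderiv two_ne_zero).bounded_above_of_compact_support (hc.fderiv ℝ)
  refine ⟨f.normed μ, max M₁ M₂, hφ, fun y hy => ?_, f.integral_normed,
    fun y => (h₁ y).trans (le_max_left _ _), fun y => (h₂ y).trans (le_max_right _ _)⟩
  by_contra h
  have hy' : y ∈ Function.support (f.normed μ) := h
  rw [f.support_normed_eq] at hy'
  simp [f] at hy'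
  linarith

end Dilation

/-- Parabolic Sobolev embedding: for `1 < d/p + 2/q = d/r + 2/s + 1` with
`p < r`, `q < s`, any `u` with `∂_t u ∈ L^q L^p`, `u ∈ L^q H^{2,p}` and `u(0)=0` satisfies
`‖∇u‖_{L^s L^r} ≤ C(d,p,q,r,s) (‖∂_t u‖_{L^q L^p} + ‖∇²u‖_{L^q L^p})`. -/
theorem stmt_7 (d : ℕ) (p q r s : ℝ)
    (hp : 1 < p) (hq : 1 < q) (hr : p < r) (hs : q < s)
    (hcrit1 : 1 < (d : ℝ) / p + 2 / q)
    (hcrit2 : (d : ℝ) / p + 2 / q = (d : ℝ) / r + 2 / s + 1) :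
    ∃ C > (0:ℝ), ∀ T : ℝ, 0 < T →
      ∀ (u ut : ℝ → EuclideanSpace ℝ (Fin d) → ℝ),
      (∀ x t, HasDerivAt (fun τ => u τ x) (ut t x) t) →
      (∀ t, ContDiff ℝ 2 (u t)) →
      (∀ x, u 0 x = 0) →
      (∫⁻ t in Set.Ioc (0:ℝ) T,
          (eLpNorm (fun x => ‖fderiv ℝ (u t) x‖) (ENNReal.ofReal r) volume) ^ s) ^ (1/s) ≤
        ENNReal.ofReal C *
          ((∫⁻ t in Set.Ioc (0:ℝ) T,
              (eLpNorm (ut t) (ENNReal.ofReal p) volume) ^ q) ^ (1/q) +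
            (∫⁻ t in Set.Ioc (0:ℝ) T,
              (eLpNorm (fun x => ‖iteratedFDeriv ℝ 2 (u t) x‖)
                (ENNReal.ofReal p) volume) ^ q) ^ (1/q)) := by
  obtain ⟨φ, M, hφ, hφ0, hφ1, hM, hM'⟩ :=
    exists_contDiff_bump (volume : Measure (EuclideanSpace ℝ (Fin d)))
  obtain ⟨C₀, hC₀⟩ := exists_lintegral_rpow_mul_rpow_le hq hs
  have hr0 : 0 < r := by linarith
  have hp0 : 0 < p := by linarith
  have hs0 : 0 < s := by linarith
  have hrp : 1 / r < 1 / p := one_div_lt_one_div_of_lt hp0 hr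
  have hp1 : 1 / p < 1 := by rw [div_lt_one hp0]; exact hp
  have hr1 : 0 < 1 / r := by positivity
  set A : ENNReal := ENNReal.ofReal M *
    volume (Metric.ball (0 : EuclideanSpace ℝ (Fin d)) 1) ^ (1 - 1 / p + 1 / r) with hA
  have hAtop : A ≠ ⊤ := ENNReal.mul_ne_top ENNReal.ofReal_ne_top
    (ENNReal.rpow_ne_top_of_nonneg (by linarith) measure_ball_lt_top.ne)
  refine ⟨A.toReal * C₀ + 1, by positivity, fun T hT u ut hder hu hu0 => ?_⟩
  have hum : Measurable (Function.uncurry u) := measurable_uncurry_of_continuous_of_measurable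
    (fun x => continuous_iff_continuousAt.2 fun t => (hder x t).continuousAt)
    fun t => (hu t).continuous.measurable
  have hutm := measurable_uncurry_of_hasDerivAt hder hum
  have hD1m := measurable_fderiv_uncurry hum fun t => (hu t).differentiable two_ne_zero
  have hD2m : Measurable fun a : ℝ × EuclideanSpace ℝ (Fin d) =>
      ‖fderiv ℝ (fderiv ℝ (u a.1)) a.2‖ₑ := by
    have h := measurable_fderiv_uncurry (h := fun t y => fderiv ℝ (u t) y) hD1m
      fun t => ((hu t).fderiv_right (m := 1) (by norm_num)).differentiable one_ne_zero
    simp_rw [← ofReal_norm]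
    exact h.norm.ennreal_ofReal
  set U : ℝ → ENNReal := fun τ => (∫⁻ y, ‖ut τ y‖ₑ ^ p) ^ (1 / p) with hUdef
  set D : ℝ → ENNReal := fun τ => (∫⁻ y, ‖fderiv ℝ (fderiv ℝ (u τ)) y‖ₑ ^ p) ^ (1 / p) with hDdef
  have hUm : Measurable U := (Measurable.lintegral_prod_right' (hutm.enorm.pow_const p)).pow_const _
  have hDm : Measurable D := (Measurable.lintegral_prod_right' (hD2m.pow_const p)).pow_const _
  have hp' : ENNReal.ofReal p ≠ 0 := by simpa using hp0
  have hr' : ENNReal.ofReal r ≠ 0 := by simpa using hr0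
  have hUeq : ∀ τ, eLpNorm (ut τ) (ENNReal.ofReal p) volume = U τ := fun τ => by
    rw [eLpNorm_eq_lintegral_rpow_enorm_toReal hp' ENNReal.ofReal_ne_top,
      ENNReal.toReal_ofReal hp0.le]
  have hDeq : ∀ τ, eLpNorm (fun x => ‖iteratedFDeriv ℝ 2 (u τ) x‖) (ENNReal.ofReal p) volume
      = D τ := fun τ => by
    rw [eLpNorm_eq_lintegral_rpow_enorm_toReal hp' ENNReal.ofReal_ne_top,
      ENNReal.toReal_ofReal hp0.le]
    simp_rw [← norm_iteratedFDeriv_fderiv (n := 1), norm_iteratedFDeriv_one, enorm_norm, hDdef]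
  simp_rw [hUeq, hDeq]
  set S := (∫⁻ t in Set.Ioc (0:ℝ) T, U t ^ q) ^ (1/q)
    + (∫⁻ t in Set.Ioc (0:ℝ) T, D t ^ q) ^ (1/q) with hS
  by_cases hStop : S = ⊤
  · rw [hStop, ENNReal.mul_top (by simpa using by positivity)]
    exact le_top
  set N : ℝ → ENNReal := (Set.Icc 0 T).indicator (U + D) with hNdef
  have hNm : Measurable N := (hUm.add hDm).indicator measurableSet_Icc
  have hNq : (∫⁻ τ, N τ ^ q) ^ (1 / q) ≤ S := by
    have h : ∀ τ, N τ ^ q = (Set.Icc 0 T).indicator (fun τ => (U + D) τ ^ q) τ := fun τ => by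
      by_cases hτ : τ ∈ Set.Icc 0 T
      · simp [hNdef, hτ]
      · simp [hNdef, hτ, (by linarith : 0 < q)]
    simp_rw [h]
    rw [lintegral_indicator measurableSet_Icc, ← restrict_Ioc_eq_restrict_Icc]
    exact ENNReal.lintegral_Lp_add_le hUm.aemeasurable hDm.aemeasurable hq.le
  have hNfin : (∫⁻ τ, N τ ^ q) ^ (1 / q) ≠ ⊤ := (hNq.trans_lt (lt_top_iff_ne_top.2 hStop)).ne
  have hexp : -(1 / 2) - (d : ℝ) / 2 * (1 / p - 1 / r) = 1 / q - 1 / s - 1 := by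
    have h1 : (d : ℝ) / 2 * (1 / p - 1 / r) = (d / p - d / r) / 2 := by ring
    have h2 : (2 : ℝ) / q = 2 * (1 / q) := by ring
    have h3 : (2 : ℝ) / s = 2 * (1 / s) := by ring
    rw [h1]
    rw [h2, h3] at hcrit2
    linarith
  have hpt : ∀ t ∈ Set.Ioc 0 T, eLpNorm (fun x => ‖fderiv ℝ (u t) x‖) (ENNReal.ofReal r) volume
      ≤ A * ∫⁻ z, ENNReal.ofReal (|z| ^ (1 / q - 1 / s - 1)) * N (t - z) := by
    intro t ht
    rw [eLpNorm_eq_lintegral_rpow_enorm_toReal hr' ENNReal.ofReal_ne_top,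
      ENNReal.toReal_ofReal hr0.le]
    simp_rw [enorm_norm]
    refine (lintegral_enorm_fderiv_rpow_le volume hφ hφ0 hφ1 hM hM' hp hr hder hu hu0 hum hutm hD2m
      ht.1.le (N := N) (fun τ hτ => ?_) ?_).trans ?_
    · have hτ' : τ ∈ Set.Icc 0 T := ⟨hτ.1, hτ.2.trans ht.2⟩
      rw [hNdef, Set.indicator_of_mem hτ']
      exact ENNReal.lintegral_Lp_add_le (hutm.comp measurable_prodMk_left).enorm.aemeasurable
        (hD2m.comp measurable_prodMk_left).aemeasurable hp.le
    · refine ((setLIntegral_sub_le_mul_rpow volume hq hNm _ t).trans_lt ?_).ne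
      refine lt_top_iff_ne_top.2 (ENNReal.mul_ne_top hNfin ?_)
      refine ENNReal.rpow_ne_top_of_nonneg ?_ measure_Ioc_lt_top.ne
      rw [sub_nonneg, div_le_one (by linarith)]
      exact hq.le
    · rw [← hA, finrank_euclideanSpace_fin, hexp]
      refine mul_le_mul' le_rfl ?_
      refine le_trans (setLIntegral_mono' measurableSet_Ioc fun σ hσ => ?_)
        (setLIntegral_le_lintegral _ _)
      rw [abs_of_pos hσ.1]
  calc _ ≤ (∫⁻ t, (A * ∫⁻ z, ENNReal.ofReal (|z| ^ (1 / q - 1 / s - 1)) * N (t - z)) ^ s)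
          ^ (1 / s) := by
        refine ENNReal.rpow_le_rpow ?_ (by positivity)
        exact (setLIntegral_mono' measurableSet_Ioc fun t ht =>
          ENNReal.rpow_le_rpow (hpt t ht) hs0.le).trans (setLIntegral_le_lintegral _ _)
    _ = A * (∫⁻ t, (∫⁻ z, ENNReal.ofReal (|z| ^ (1 / q - 1 / s - 1)) * N (t - z)) ^ s)
          ^ (1 / s) := by
        simp_rw [ENNReal.mul_rpow_of_nonneg _ _ hs0.le]
        rw [lintegral_const_mul' _ _ (ENNReal.rpow_ne_top_of_nonneg hs0.le hAtop),
          ENNReal.mul_rpow_of_nonneg _ _ (by positivity), ← ENNReal.rpow_mul,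
          mul_one_div_cancel hs0.ne', ENNReal.rpow_one]
    _ ≤ A * (C₀ * S) := by
        gcongr
        exact (hC₀ N hNm).trans (by gcongr)
    _ ≤ ENNReal.ofReal (A.toReal * C₀ + 1) * S := by
        rw [← mul_assoc]
        gcongr
        rw [ENNReal.ofReal_add (by positivity) zero_le_one,
          ENNReal.ofReal_mul ENNReal.toReal_nonneg, ENNReal.ofReal_toReal hAtop,
          ENNReal.ofReal_coe_nnreal]
        exact le_self_add
end

section
/- Let d ≥ 2, let j, m ∈ ℕ with 0 < j < m, and let 1 < p < q < ∞ satisfy pm/j < q ≤ p(m−1)/(j−1). Set α = (jq − mp)/(q − p) and θ = p/q. Then for all u ∈ H^{m,p}(ℝ^d) ∩ C^α(ℝ^d), ‖∇^j u‖_{L^q} ≤ C ‖∇^m u‖_{L^p}^θ · [u]_{C^α}^{1−θ}, with C depending only on d, j, m, p, q. -/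
open MeasureTheory

section Maximal

open Metric Set
open scoped ENNReal

variable {E : Type*} [NormedAddCommGroup E] [MeasurableSpace E]

/-- The uncentered Hardy–Littlewood maximal function. -/
noncomputable def maximalFunction (μ : Measure E) (g : E → ℝ≥0∞) (x : E) : ℝ≥0∞ :=
  ⨆ (c : E) (r : ℝ) (_ : x ∈ ball c r), (∫⁻ y in ball c r, g y ∂μ) / μ (ball c r)

theorem lt_maximalFunction_iff {μ : Measure E} {g : E → ℝ≥0∞} {x : E} {t : ℝ≥0∞} :
    t < maximalFunction μ g x ↔
      ∃ c r, x ∈ ball c r ∧ t < (∫⁻ y in ball c r, g y ∂μ) / μ (ball c r) := by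
  simp [maximalFunction, lt_iSup_iff]

theorem isOpen_lt_maximalFunction (μ : Measure E) (g : E → ℝ≥0∞) (t : ℝ≥0∞) :
    IsOpen {x | t < maximalFunction μ g x} := by
  refine isOpen_iff_mem_nhds.2 fun x hx => ?_
  obtain ⟨c, r, hxc, h⟩ := lt_maximalFunction_iff.1 hx
  filter_upwards [isOpen_ball.mem_nhds hxc] with y hy
  exact lt_maximalFunction_iff.2 ⟨c, r, hy, h⟩

theorem measurable_maximalFunction [BorelSpace E] (μ : Measure E) (g : E → ℝ≥0∞) :
    Measurable (maximalFunction μ g) :=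
  measurable_of_Ioi fun t => (isOpen_lt_maximalFunction μ g t).measurableSet

variable [NormedSpace ℝ E] [FiniteDimensional ℝ E] (μ : Measure E) [μ.IsAddHaarMeasure]

theorem setLIntegral_ball_le_measure_mul_maximalFunction (g : E → ℝ≥0∞) {x c : E} {r : ℝ}
    (hx : x ∈ ball c r) :
    ∫⁻ y in ball c r, g y ∂μ ≤ μ (ball c r) * maximalFunction μ g x := by
  have h0 : μ (ball c r) ≠ 0 := (isOpen_ball.measure_pos μ ⟨x, hx⟩).ne'
  have h : (∫⁻ y in ball c r, g y ∂μ) / μ (ball c r) ≤ maximalFunction μ g x :=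
    le_iSup_of_le c (le_iSup_of_le r (le_iSup_of_le hx le_rfl))
  rw [mul_comm]
  exact (ENNReal.div_le_iff h0 measure_ball_lt_top.ne).1 h

theorem maximalFunction_le_indicator_add (g : E → ℝ≥0∞) (t : ℝ≥0∞) (x : E) :
    maximalFunction μ g x ≤ maximalFunction μ ({y | t < g y}.indicator g) x + t := by
  refine iSup_le fun c => iSup_le fun r => iSup_le fun hx => ?_
  have h0 : μ (ball c r) ≠ 0 := (isOpen_ball.measure_pos μ ⟨x, hx⟩).ne'
  rw [ENNReal.div_le_iff h0 measure_ball_lt_top.ne]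
  calc ∫⁻ y in ball c r, g y ∂μ
      ≤ ∫⁻ y in ball c r, ({y | t < g y}.indicator g y + t) ∂μ := by
        refine lintegral_mono fun y => ?_
        by_cases hy : t < g y
        · simp [hy]
        · simpa [hy] using not_lt.1 hy
    _ = ∫⁻ y in ball c r, {y | t < g y}.indicator g y ∂μ + t * μ (ball c r) := by
        rw [lintegral_add_right _ measurable_const]
        simp
    _ ≤ _ := by
        rw [add_mul, mul_comm (maximalFunction _ _ _)]
        gcongr
        exact setLIntegral_ball_le_measure_mul_maximalFunction μ _ hx

variable [BorelSpace E]

/-- The weak type `(1, 1)` bound for the maximal function. -/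
theorem mul_measure_lt_maximalFunction_le (g : E → ℝ≥0∞) (t : ℝ≥0∞) :
    t * μ {x | t < maximalFunction μ g x} ≤
      ENNReal.ofReal (5 ^ Module.finrank ℝ E) * ∫⁻ x, g x ∂μ := by
  rw [(isOpen_lt_maximalFunction μ g t).measure_eq_iSup_isCompact]
  simp only [ENNReal.mul_iSup]
  refine iSup_le fun K => iSup_le fun hKU => iSup_le fun hK => ?_
  choose! c r hmem hlt using fun x (hx : x ∈ K) => lt_maximalFunction_iff.1 (hKU hx)
  obtain ⟨s, hsK, hs⟩ := hK.elim_nhds_subcover (fun x => ball (c x) (r x))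
    fun x hx => isOpen_ball.mem_nhds (hmem x hx)
  obtain ⟨R, hR⟩ := (s.image r).exists_le
  obtain ⟨u, hus, hdisj, hcov⟩ :=
    Vitali.exists_disjoint_subfamily_covering_enlargement_closedBall (s : Set E) c r R
      (fun a ha => hR _ (Finset.mem_image_of_mem r ha)) 4 (by norm_num)
  have huc : u.Finite := s.finite_toSet.subset hus
  have hpos : ∀ b ∈ u, 0 < r b := fun b hb =>
    dist_nonneg.trans_lt (mem_ball.1 (hmem b (hsK b (hus hb))))
  have hKcov : K ⊆ ⋃ b ∈ u, ball (c b) (5 * r b) := by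
    refine hs.trans (iUnion₂_subset fun a ha => ?_)
    obtain ⟨b, hb, hab⟩ := hcov a ha
    refine ball_subset_closedBall.trans (hab.trans ((closedBall_subset_ball ?_).trans
      (subset_biUnion_of_mem (u := fun b => ball (c b) (5 * r b)) hb)))
    linarith [hpos b hb]
  have hball : ∀ b ∈ u, t * μ (ball (c b) (5 * r b)) ≤
      ENNReal.ofReal (5 ^ Module.finrank ℝ E) * ∫⁻ y in ball (c b) (r b), g y ∂μ := by
    intro b hb
    have h0 : μ (ball (c b) (r b)) ≠ 0 := (measure_ball_pos μ _ (hpos b hb)).ne'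
    have h1 : t * μ (ball (c b) (r b)) ≤ ∫⁻ y in ball (c b) (r b), g y ∂μ :=
      (ENNReal.le_div_iff_mul_le (.inl h0) (.inl measure_ball_lt_top.ne)).1
        (hlt b (hsK b (hus hb))).le
    rw [Measure.addHaar_ball_mul_of_pos μ _ (by norm_num : (0 : ℝ) < 5),
      ← Measure.addHaar_ball_center μ (c b),
      mul_left_comm]
    gcongr
  calc t * μ K ≤ t * ∑ b ∈ huc.toFinset, μ (ball (c b) (5 * r b)) := by
        gcongr
        refine (measure_mono hKcov).trans ?_
        have := measure_biUnion_finset_le (μ := μ) huc.toFinset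
          fun b => ball (c b) (5 * r b)
        simpa using this
    _ ≤ ∑ b ∈ huc.toFinset, ENNReal.ofReal (5 ^ Module.finrank ℝ E) *
          ∫⁻ y in ball (c b) (r b), g y ∂μ := by
        rw [Finset.mul_sum]
        exact Finset.sum_le_sum fun b hb => hball b (huc.mem_toFinset.1 hb)
    _ = ENNReal.ofReal (5 ^ Module.finrank ℝ E) *
          ∫⁻ y in ⋃ b ∈ huc.toFinset, ball (c b) (r b), g y ∂μ := by
        rw [← Finset.mul_sum, lintegral_biUnion_finset _ fun b _ => measurableSet_ball]
        intro a ha b hb hab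
        exact (hdisj (huc.mem_toFinset.1 ha) (huc.mem_toFinset.1 hb) hab).mono
          ball_subset_closedBall ball_subset_closedBall
    _ ≤ _ := mul_le_mul_right (setLIntegral_le_lintegral _ _) _

theorem ENNReal.rpow_eq_lintegral_Ioi (a : ℝ≥0∞) {p : ℝ} (hp : 0 < p) :
    a ^ p = ENNReal.ofReal p *
      ∫⁻ t in Ioi (0 : ℝ), {t | ENNReal.ofReal t < a}.indicator
        (fun t => ENNReal.ofReal (t ^ (p - 1))) t := by
  have key : ∀ b : ℝ, 0 ≤ b → ENNReal.ofReal b ^ p = ENNReal.ofReal p *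
      ∫⁻ t in Ioi (0 : ℝ), {t | ENNReal.ofReal t < ENNReal.ofReal b}.indicator
        (fun t => ENNReal.ofReal (t ^ (p - 1))) t := by
    intro b hb
    have := lintegral_rpow_eq_lintegral_meas_lt_mul (Measure.dirac ()) (f := fun _ => b)
      (Filter.Eventually.of_forall fun _ => hb) measurable_const.aemeasurable hp
    rw [lintegral_dirac, ← ENNReal.ofReal_rpow_of_nonneg hb hp.le] at this
    rw [this]
    congr 1
    refine setLIntegral_congr_fun measurableSet_Ioi fun t ht => ?_
    by_cases h : t < b
    · simp [h, (mem_Ioi.1 ht).trans h]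
    · simp [ENNReal.ofReal_lt_ofReal_iff_of_nonneg (mem_Ioi.1 ht).le, h]
  rcases eq_or_ne a ∞ with rfl | ha
  · rw [ENNReal.top_rpow_of_pos hp, eq_comm, eq_top_iff]
    refine ENNReal.le_of_forall_nnreal_lt fun N _ => ?_
    have h := key ((N : ℝ) ^ p⁻¹) (by positivity)
    rw [ENNReal.ofReal_rpow_of_nonneg (by positivity) hp.le, ← Real.rpow_mul N.coe_nonneg,
      inv_mul_cancel₀ hp.ne', Real.rpow_one, ENNReal.ofReal_coe_nnreal] at h
    rw [h]
    gcongr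
    exact le_top
  · simpa [ENNReal.ofReal_toReal ha] using key a.toReal ENNReal.toReal_nonneg

theorem lintegral_rpow_eq_lintegral_Ioi_measure {X : Type*} [MeasurableSpace X] (ν : Measure X)
    [SFinite ν] {F : X → ℝ≥0∞} (hF : Measurable F) {p : ℝ} (hp : 0 < p) :
    ∫⁻ x, F x ^ p ∂ν = ENNReal.ofReal p *
      ∫⁻ t in Ioi (0 : ℝ), ENNReal.ofReal (t ^ (p - 1)) * ν {x | ENNReal.ofReal t < F x} := by
  have hm : MeasurableSet {z : X × ℝ | ENNReal.ofReal z.2 < F z.1} :=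
    measurableSet_lt (by fun_prop) (by fun_prop)
  have hm' : Measurable fun z : X × ℝ => {t | ENNReal.ofReal t < F z.1}.indicator
      (fun t => ENNReal.ofReal (t ^ (p - 1))) z.2 :=
    Measurable.indicator (f := fun z : X × ℝ => ENNReal.ofReal (z.2 ^ (p - 1)))
      (by fun_prop) hm
  simp_rw [fun x => ENNReal.rpow_eq_lintegral_Ioi (F x) hp]
  rw [lintegral_const_mul _ hm'.lintegral_prod_right', lintegral_lintegral_swap hm'.aemeasurable]
  congr 1
  refine lintegral_congr fun t => ?_
  rw [← lintegral_indicator_const (measurableSet_lt measurable_const hF)]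
  rfl

/-- The Hardy–Littlewood maximal inequality. -/
theorem lintegral_maximalFunction_rpow_le {g : E → ℝ≥0∞} (hg : Measurable g) {p : ℝ}
    (hp : 1 < p) :
    ∫⁻ x, maximalFunction μ g x ^ p ∂μ ≤
      ENNReal.ofReal (p * (2 * 5 ^ Module.finrank ℝ E) * (p - 1)⁻¹ * 2 ^ (p - 1)) *
        ∫⁻ x, g x ^ p ∂μ := by
  obtain ⟨A, hA⟩ : ∃ A : ℝ, A = 2 * 5 ^ Module.finrank ℝ E := ⟨_, rfl⟩
  rw [← hA]
  have hp1 : 0 < p - 1 := sub_pos.2 hp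
  have hp0 : 0 < p := zero_lt_one.trans hp
  set ν := μ.withDensity g
  have hweak : ∀ t ∈ Ioi (0 : ℝ),
      ENNReal.ofReal (t ^ (p - 1)) * μ {x | ENNReal.ofReal t < maximalFunction μ g x} ≤
      ENNReal.ofReal A *
        (ENNReal.ofReal (t ^ (p - 1 - 1)) * ν {x | ENNReal.ofReal t < 2 * g x}) := by
    intro t ht
    have ht : 0 < t := ht
    have hsub : {x | ENNReal.ofReal t < maximalFunction μ g x} ⊆ {x | ENNReal.ofReal (t / 2) <
        maximalFunction μ ({y | ENNReal.ofReal (t / 2) < g y}.indicator g) x} := by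
      intro x hx
      by_contra hcon
      refine (not_le.2 hx) ((maximalFunction_le_indicator_add μ g
        (ENNReal.ofReal (t / 2)) x).trans ((add_le_add_left (not_lt.1 hcon) _).trans ?_))
      rw [← ENNReal.ofReal_add (by positivity) (by positivity), add_halves]
    have hset : {x | ENNReal.ofReal t < 2 * g x} = {y | ENNReal.ofReal (t / 2) < g y} := by
      ext x
      rw [mem_ofPred_eq, mem_ofPred_eq, ENNReal.ofReal_div_of_pos two_pos,
        ENNReal.div_lt_iff (by simp) (by simp), mul_comm]
      simp
    have hmeas : MeasurableSet {y | ENNReal.ofReal (t / 2) < g y} :=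
      measurableSet_lt measurable_const hg
    have h1 := mul_measure_lt_maximalFunction_le μ
      ({y | ENNReal.ofReal (t / 2) < g y}.indicator g) (ENNReal.ofReal (t / 2))
    rw [lintegral_indicator hmeas, ← withDensity_apply _ hmeas, ← hset] at h1
    have hpow : t ^ (p - 1) = 2 * t ^ (p - 1 - 1) * (t / 2) := by
      rw [Real.rpow_sub_one ht.ne' (p - 1)]; field_simp
    rw [hpow, ENNReal.ofReal_mul (by positivity), mul_assoc]
    calc _ ≤ ENNReal.ofReal (2 * t ^ (p - 1 - 1)) * (ENNReal.ofReal (5 ^ Module.finrank ℝ E) *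
          ν {x | ENNReal.ofReal t < 2 * g x}) := by
          rw [← hset] at hsub
          refine mul_le_mul_right (le_trans (mul_le_mul_right (measure_mono ?_) _) h1) _
          exact hsub
      _ = _ := by
          rw [hA, ENNReal.ofReal_mul two_pos.le, ENNReal.ofReal_mul two_pos.le]
          ring
  have hlay := lintegral_rpow_eq_lintegral_Ioi_measure ν (hg.const_mul 2) hp1
  have hdens : ∫⁻ x, (2 * g x) ^ (p - 1) ∂ν = ENNReal.ofReal (2 ^ (p - 1)) * ∫⁻ x, g x ^ p ∂μ := by
    rw [lintegral_withDensity_eq_lintegral_mul _ hg (by fun_prop),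
      ← lintegral_const_mul _ (by fun_prop)]
    refine lintegral_congr fun x => ?_
    have h2 : g x ^ p = g x * g x ^ (p - 1) := by
      nth_rewrite 2 [← ENNReal.rpow_one (g x)]
      rw [← ENNReal.rpow_add_of_nonneg _ _ zero_le_one hp1.le]
      congr 1; ring
    rw [Pi.mul_apply, ENNReal.mul_rpow_of_nonneg _ _ hp1.le, h2,
      ← ENNReal.ofReal_rpow_of_pos two_pos]
    simp only [ENNReal.ofReal_ofNat]
    ring
  have hintegral : ∫⁻ t in Ioi (0 : ℝ), ENNReal.ofReal (t ^ (p - 1 - 1)) *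
      ν {x | ENNReal.ofReal t < 2 * g x} =
      ENNReal.ofReal ((p - 1)⁻¹) * (ENNReal.ofReal (2 ^ (p - 1)) * ∫⁻ x, g x ^ p ∂μ) := by
    rw [← hdens, hlay, ← mul_assoc, ← ENNReal.ofReal_mul (by positivity),
      inv_mul_cancel₀ hp1.ne', ENNReal.ofReal_one, one_mul]
  rw [lintegral_rpow_eq_lintegral_Ioi_measure μ (measurable_maximalFunction μ g) hp0]
  calc _ ≤ ENNReal.ofReal p * ∫⁻ t in Ioi (0 : ℝ), ENNReal.ofReal A *
        (ENNReal.ofReal (t ^ (p - 1 - 1)) * ν {x | ENNReal.ofReal t < 2 * g x}) := by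
        exact mul_le_mul_right (setLIntegral_mono' measurableSet_Ioi hweak) _
    _ = _ := by
        have hA0 : 0 ≤ A := by rw [hA]; positivity
        rw [lintegral_const_mul' _ _ ENNReal.ofReal_ne_top, hintegral,
          ENNReal.ofReal_mul (by positivity), ENNReal.ofReal_mul (by positivity),
          ENNReal.ofReal_mul hp0.le]
        ring

/-- Averages of `g` over dilated balls are controlled by the maximal function. -/
theorem setLIntegral_ball_comp_add_smul_le {g : E → ℝ≥0∞} (hg : Measurable g) (x : E) {τ r : ℝ}
    (hτ : 0 < τ) (hr : 0 < r) :
    ∫⁻ y in ball (0 : E) r, g (x + τ • y) ∂μ ≤ μ (ball 0 r) * maximalFunction μ g x := by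
  have hball : ball (0 : E) r = (fun y : E => x + τ • y) ⁻¹' ball x (τ * r) := by
    ext y
    simp [norm_smul, abs_of_pos hτ, hτ]
  have hmap : Measure.map (fun y : E => x + τ • y) μ =
      ENNReal.ofReal ((τ ^ Module.finrank ℝ E)⁻¹) • μ := by
    rw [show (fun y : E => x + τ • y) = (fun z => x + z) ∘ (fun y => τ • y) from rfl,
      ← Measure.map_map (by fun_prop) (by fun_prop), Measure.map_addHaar_smul μ hτ.ne',
      Measure.map_smul, map_add_left_eq_self, abs_of_pos (by positivity)]
  have hmeas : Measurable fun y : E => x + τ • y := by fun_prop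
  calc ∫⁻ y in ball (0 : E) r, g (x + τ • y) ∂μ
      = ENNReal.ofReal ((τ ^ Module.finrank ℝ E)⁻¹) * ∫⁻ z in ball x (τ * r), g z ∂μ := by
        rw [hball, ← setLIntegral_map measurableSet_ball hg hmeas, hmap,
          Measure.restrict_smul, lintegral_smul_measure, smul_eq_mul]
    _ ≤ ENNReal.ofReal ((τ ^ Module.finrank ℝ E)⁻¹) *
          (μ (ball x (τ * r)) * maximalFunction μ g x) := by
        gcongr
        exact setLIntegral_ball_le_measure_mul_maximalFunction μ g
          (mem_ball_self (by positivity))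
    _ = _ := by
        rw [Measure.addHaar_ball_mul_of_pos μ x hτ, ← mul_assoc, ← mul_assoc,
          ← ENNReal.ofReal_mul (by positivity), inv_mul_cancel₀ (by positivity),
          ENNReal.ofReal_one, one_mul]

end Maximal

section IteratedDerivative

variable {E F : Type*} [NormedAddCommGroup E] [NormedSpace ℝ E]
  [NormedAddCommGroup F] [NormedSpace ℝ F]

open Equiv in
/-- The `n`-th derivative of a function of class `C^n` over the reals is symmetric. -/
theorem ContDiff.iteratedFDeriv_comp_perm_real {f : E → F} {n : ℕ} (hf : ContDiff ℝ n f) (x : E)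
    (v : Fin n → E) (σ : Perm (Fin n)) :
    iteratedFDeriv ℝ n f x (v ∘ σ) = iteratedFDeriv ℝ n f x v := by
  induction n generalizing x with
  | zero => congr 1; exact Subsingleton.elim _ _
  | succ n ih =>
    have hσ : σ ∈ Submonoid.closure
        (Set.range fun i : Fin n => swap i.castSucc i.succ) := by
      rw [Perm.mclosure_swap_castSucc_succ]; trivial
    induction hσ using Submonoid.closure_induction generalizing v with
    | one => rfl
    | mul σ τ _ _ hσ hτ =>
      rw [Perm.coe_mul, ← Function.comp_assoc, hτ, hσ]
    | mem σ hσ =>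
      obtain ⟨i, rfl⟩ := hσ
      cases n with
      | zero => exact i.elim0
      | succ n =>
        induction i using Fin.cases with
        | zero =>
          have hsymm : IsSymmSndFDerivAt ℝ (iteratedFDeriv ℝ n f) x := by
            refine ContDiffAt.isSymmSndFDerivAt (n := 2) ?_ (by simp)
            refine (hf.iteratedFDeriv_right (m := 2) (i := n) ?_).contDiffAt
            norm_cast; omega
          have key : ∀ w : Fin (n + 2) → E, iteratedFDeriv ℝ (n + 2) f x w =
              fderiv ℝ (fderiv ℝ (iteratedFDeriv ℝ n f)) x (w 0) (w 1)
                (Fin.tail (Fin.tail w)) := by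
            intro w
            have hd : DifferentiableAt ℝ (iteratedFDeriv ℝ (n + 1) f) x :=
              hf.differentiable_iteratedFDeriv (by norm_cast; omega) x
            have hd' : DifferentiableAt ℝ (fderiv ℝ (iteratedFDeriv ℝ n f)) x :=
              (((hf.iteratedFDeriv_right (m := 2) (i := n) (by norm_cast; omega)).fderiv_right
                (m := 1) (by norm_num)).differentiable (by norm_num)) x
            have hd'' : DifferentiableAt ℝ
                (fun y => fderiv ℝ (iteratedFDeriv ℝ n f) y (w 1)) x := by fun_prop
            rw [hd.iteratedFDeriv_succ_apply_left']
            simp_rw [iteratedFDeriv_succ_apply_left]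
            change fderiv ℝ (fun y => fderiv ℝ (iteratedFDeriv ℝ n f) y (w 1)
              (Fin.tail (Fin.tail w))) x (w 0) = _
            rw [fderiv_continuousMultilinear_apply_const_apply hd'',
              fderiv_clm_apply hd' (differentiableAt_const _)]
            simp
          rw [key, key, hsymm.eq]
          congr 2
        | succ k =>
          have hd : DifferentiableAt ℝ (iteratedFDeriv ℝ (n + 1) f) x :=
            hf.differentiable_iteratedFDeriv (by norm_cast; omega) x
          have h0 : (v ∘ swap k.succ.castSucc k.succ.succ) 0 = v 0 := by
            rw [Function.comp_apply, swap_apply_of_ne_of_ne (by simp [Fin.ext_iff])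
              (by simp [Fin.ext_iff])]
          have ht : Fin.tail (v ∘ swap k.succ.castSucc k.succ.succ) =
              Fin.tail v ∘ swap k.castSucc k.succ := by
            ext i
            simp only [Fin.tail, Function.comp_apply, Fin.castSucc_succ]
            rw [(Fin.succ_injective _).swap_apply]
          rw [hd.iteratedFDeriv_succ_apply_left', hd.iteratedFDeriv_succ_apply_left', h0, ht]
          simp_rw [ih (hf.of_le (by norm_cast; omega))]

/-- Polarization: alternating sums of the diagonal values of a multilinear map recover its
symmetrization. -/
theorem ContinuousMultilinearMap.sum_powerset_neg_one_pow_map_add_sum {j : ℕ}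
    (T : ContinuousMultilinearMap ℝ (fun _ : Fin j => E) F) (v : Fin j → E) (y : E) :
    ∑ S : Finset (Fin j), (-1 : ℝ) ^ S.card • T (fun _ => y + ∑ i ∈ S, v i) =
      (-1 : ℝ) ^ j • ∑ σ : Equiv.Perm (Fin j), T (v ∘ σ) := by
  classical
  let w : Option (Fin j) → E := fun o => o.elim y v
  let R : (Fin j → Option (Fin j)) → Finset (Fin j) :=
    fun r => Finset.eraseNone (Finset.univ.image r)
  have hexp : ∀ S : Finset (Fin j), T (fun _ => y + ∑ i ∈ S, v i) =
      ∑ r : Fin j → Option (Fin j), if R r ⊆ S then T (w ∘ r) else 0 := by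
    intro S
    have h1 : y + ∑ i ∈ S, v i = ∑ o ∈ Finset.insertNone S, w o := by
      rw [Finset.sum_insertNone]; rfl
    rw [h1, T.map_sum_finset (fun _ => w) (fun _ => Finset.insertNone S), ← Finset.sum_filter]
    refine Finset.sum_congr ?_ fun _ _ => rfl
    ext r
    simp only [Fintype.mem_piFinset, Finset.mem_filter, Finset.mem_univ, true_and, R,
      Finset.subset_iff, Finset.mem_eraseNone, Finset.mem_image, Finset.mem_insertNone,
      Option.mem_def]
    exact ⟨fun h i ⟨a, ha⟩ => h a i ha, fun h a i ha => h ⟨a, ha⟩⟩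
  have hsum : ∀ r : Fin j → Option (Fin j),
      ∑ S : Finset (Fin j), (-1 : ℝ) ^ S.card • (if R r ⊆ S then T (w ∘ r) else 0) =
        if R r = Finset.univ then (-1 : ℝ) ^ j • T (w ∘ r) else 0 := by
    intro r
    have h2 : ∀ S : Finset (Fin j), (if R r ⊆ S then (-1 : ℝ) ^ S.card else 0) =
        (∏ _i ∈ S, (-1 : ℝ)) * ∏ i ∈ Finset.univ \ S, if i ∈ R r then (0 : ℝ) else 1 := by
      intro S
      rw [Finset.prod_const]
      split_ifs with h
      · rw [Finset.prod_eq_one, mul_one]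
        intro i hi
        rw [if_neg fun hR => (Finset.mem_sdiff.1 hi).2 (h hR)]
      · obtain ⟨i, hi, hiS⟩ := Finset.not_subset.1 h
        have h0 : ∏ i ∈ Finset.univ \ S, (if i ∈ R r then (0 : ℝ) else 1) = 0 :=
          Finset.prod_eq_zero (i := i) (by simpa using hiS) (if_pos hi)
        rw [h0, mul_zero]
    have h3 := Finset.prod_add (fun _ : Fin j => (-1 : ℝ)) (fun i => if i ∈ R r then (0 : ℝ) else 1)
      Finset.univ
    rw [Finset.powerset_univ] at h3
    calc _ = (∑ S : Finset (Fin j), if R r ⊆ S then (-1 : ℝ) ^ S.card else 0) • T (w ∘ r) := by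
          rw [Finset.sum_smul]
          refine Finset.sum_congr rfl fun S _ => ?_
          split_ifs <;> simp
      _ = _ := by
          simp_rw [h2]
          rw [← h3]
          split_ifs with h
          · simp [h]
          · obtain ⟨i, hi⟩ : ∃ i, i ∉ R r := by
              by_contra! hcon
              exact h (Finset.eq_univ_iff_forall.2 hcon)
            rw [Finset.prod_eq_zero (Finset.mem_univ i) (by simp [hi]), zero_smul]
  simp_rw [hexp, Finset.smul_sum]
  rw [Finset.sum_comm]
  simp_rw [hsum]
  rw [← Finset.sum_filter]
  symm
  refine Finset.sum_bij (fun (σ : Equiv.Perm (Fin j)) _ => fun i => some (σ i)) ?_ ?_ ?_ ?_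
  · intro σ _
    simp only [Finset.mem_filter, Finset.mem_univ, true_and, Finset.eq_univ_iff_forall, R,
      Finset.mem_eraseNone, Finset.mem_image]
    exact fun i => ⟨σ.symm i, by simp⟩
  · intro σ _ τ _ h
    ext i
    have := congrFun h i
    simp_all
  · intro r hr
    simp only [Finset.mem_filter, Finset.mem_univ, true_and, Finset.eq_univ_iff_forall, R,
      Finset.mem_eraseNone, Finset.mem_image] at hr
    choose s hs using hr
    have hinj : Function.Injective s := fun a b hab => by
      have := (hs a).symm.trans (hab ▸ hs b)
      simpa using this
    let τ := Equiv.ofBijective s (Finite.injective_iff_bijective.1 hinj)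
    refine ⟨τ.symm, Finset.mem_univ _, funext fun i => ?_⟩
    rw [← hs (τ.symm i)]
    congr 1
    exact τ.apply_symm_apply i
  · intro σ _
    rfl

end IteratedDerivative

section Taylor

open Polynomial in
/-- The coefficients of a polynomial of degree less than `m` are linear combinations of its values
at `m` distinct points. -/
theorem Polynomial.exists_coeff_eq_sum_mul_eval {m : ℕ} (j : ℕ) {s : ℕ → ℝ}
    (hs : Set.InjOn s (Finset.range m)) :
    ∃ c : ℕ → ℝ, ∀ f : ℝ[X], f.degree < m →
      f.coeff j = ∑ i ∈ Finset.range m, c i * f.eval (s i) := by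
  refine ⟨fun i => (Lagrange.basis (Finset.range m) s i).coeff j, fun f hf => ?_⟩
  have h := congrArg (fun g => coeff g j) (Lagrange.eq_interpolate hs (by simpa using hf))
  simp only [Lagrange.interpolate_apply, finsetSum_coeff, coeff_C_mul] at h
  rw [h]
  exact Finset.sum_congr rfl fun i _ => mul_comm _ _

variable {E : Type*} [NormedAddCommGroup E] [NormedSpace ℝ E]

open Set Nat in
/-- The Taylor remainder of order `n + 1` in the direction `s • y`. -/
theorem enorm_sub_taylor_le {u : E → ℝ} {n : ℕ} (hu : ContDiff ℝ (n + 1 : ℕ) u) (x y : E) {s : ℝ}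
    (hs : s ∈ Ioc (0 : ℝ) 1) :
    ‖u (x + s • y) - ∑ k ∈ Finset.range (n + 1),
        ((k ! : ℝ)⁻¹ * iteratedFDeriv ℝ k u x (fun _ => y)) * s ^ k‖ₑ ≤
      ENNReal.ofReal (‖y‖ ^ (n + 1)) *
        ∫⁻ t in Ioc (0 : ℝ) 1, ‖iteratedFDeriv ℝ (n + 1) u (x + (t * s) • y)‖ₑ := by
  have h := map_add_eq_sum_add_integral_iteratedFDeriv (f := u) (n := n) (x := x) (y := s • y)
    (fun t _ => by exact_mod_cast hu.contDiffAt)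
  have hpoly : ∑ k ∈ Finset.range (n + 1),
      (k ! : ℝ)⁻¹ • (iteratedFDeriv ℝ k u x (fun _ => s • y)) = ∑ k ∈ Finset.range (n + 1),
        ((k ! : ℝ)⁻¹ * iteratedFDeriv ℝ k u x (fun _ => y)) * s ^ k := by
    refine Finset.sum_congr rfl fun k _ => ?_
    rw [ContinuousMultilinearMap.map_smul_univ _ (fun _ => s) (fun _ => y)]
    simp only [smul_eq_mul, Finset.prod_const, Finset.card_univ, Fintype.card_fin]
    ring
  rw [h, hpoly, add_sub_cancel_left, intervalIntegral.integral_of_le zero_le_one, enorm_smul,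
    ← lintegral_const_mul' _ _ ENNReal.ofReal_ne_top]
  have hfac : ‖(n ! : ℝ)⁻¹‖ₑ ≤ 1 := by
    rw [← ofReal_norm, ENNReal.ofReal_le_one, norm_inv, Real.norm_natCast]
    exact inv_le_one_of_one_le₀ (by exact_mod_cast Nat.one_le_of_lt (Nat.factorial_pos n))
  refine (mul_le_mul_left hfac _).trans ?_
  rw [one_mul]
  refine (enorm_integral_le_lintegral_enorm _).trans (setLIntegral_mono' measurableSet_Ioc ?_)
  intro t ht
  rw [← ofReal_norm, ← ofReal_norm, ← ENNReal.ofReal_mul (by positivity),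
    norm_smul, smul_smul]
  refine ENNReal.ofReal_le_ofReal ?_
  have h1 : ‖(1 - t) ^ n‖ ≤ 1 := by
    rw [norm_pow, Real.norm_eq_abs]
    exact pow_le_one₀ (abs_nonneg _) (abs_le.2 ⟨by linarith [ht.2], by linarith [ht.1]⟩)
  have h2 := (iteratedFDeriv ℝ (n + 1) u (x + (t * s) • y)).le_opNorm (fun _ => s • y)
  have h3 : ‖s • y‖ ≤ ‖y‖ := by
    rw [norm_smul, Real.norm_eq_abs, abs_of_pos hs.1]
    exact mul_le_of_le_one_left (norm_nonneg _) hs.2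
  rw [Finset.prod_const, Finset.card_univ, Fintype.card_fin] at h2
  calc _ ≤ 1 * (‖iteratedFDeriv ℝ (n + 1) u (x + (t * s) • y)‖ * ‖s • y‖ ^ (n + 1)) := by gcongr
    _ ≤ _ := by rw [one_mul, mul_comm]; gcongr

open Set Nat in
/-- Diagonal values of intermediate derivatives are controlled by a Hölder bound on the function
and by averages of the highest derivative. -/
theorem exists_enorm_iteratedFDeriv_diag_le {n j : ℕ} (hj : 0 < j) (hjn : j < n + 1) {s : ℕ → ℝ}
    (hs : Set.InjOn s (Finset.range (n + 1))) (hs01 : ∀ i ∈ Finset.range (n + 1), s i ∈ Ioc 0 1)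
    {α : ℝ} (hα : 0 ≤ α) :
    ∃ C : ℝ, 0 < C ∧ ∀ {u : E → ℝ} {K : ℝ}, 0 ≤ K → ContDiff ℝ (n + 1 : ℕ) u →
      (∀ x y, |u x - u y| ≤ K * ‖x - y‖ ^ α) → ∀ x y,
      ‖iteratedFDeriv ℝ j u x (fun _ => y)‖ₑ ≤ ENNReal.ofReal C *
        (ENNReal.ofReal (K * ‖y‖ ^ α) + ENNReal.ofReal (‖y‖ ^ (n + 1)) *
          ∑ i ∈ Finset.range (n + 1),
            ∫⁻ t in Ioc (0 : ℝ) 1, ‖iteratedFDeriv ℝ (n + 1) u (x + (t * s i) • y)‖ₑ) := by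
  obtain ⟨c, hc⟩ := Polynomial.exists_coeff_eq_sum_mul_eval j hs
  refine ⟨j ! * (∑ i ∈ Finset.range (n + 1), |c i| + 1), by positivity, ?_⟩
  intro u K hK hu hhol x y
  set a : ℕ → ℝ := fun k => (k ! : ℝ)⁻¹ * iteratedFDeriv ℝ k u x (fun _ => y) with ha
  set R : ℕ → ENNReal := fun i =>
    ∫⁻ t in Ioc (0 : ℝ) 1, ‖iteratedFDeriv ℝ (n + 1) u (x + (t * s i) • y)‖ₑ with hR
  have haj : a j = ∑ i ∈ Finset.range (n + 1),
      c i * ((u x - u (x + s i • y)) + (u (x + s i • y) -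
        ∑ k ∈ Finset.range (n + 1), a k * s i ^ k)) * (-1) := by
    have h0 := hc (Polynomial.C (u x)) (Polynomial.degree_C_le.trans_lt (by norm_cast; omega))
    have h1 := hc (∑ k ∈ Finset.range (n + 1), Polynomial.C (a k) * Polynomial.X ^ k) (by
      refine (Polynomial.degree_sum_le _ _).trans_lt ((Finset.sup_lt_iff (by
        exact WithBot.bot_lt_coe _)).2 fun k hk => ?_)
      exact (Polynomial.degree_C_mul_X_pow_le _ _).trans_lt (by
        exact_mod_cast Finset.mem_range.1 hk))
    simp only [Polynomial.coeff_C, hj.ne', if_false, Polynomial.eval_C] at h0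
    simp only [Polynomial.finsetSum_coeff, Polynomial.coeff_C_mul_X_pow, Polynomial.eval_finsetSum,
      Polynomial.eval_mul, Polynomial.eval_C, Polynomial.eval_pow, Polynomial.eval_X,
      Finset.sum_ite_eq, Finset.mem_range, hjn, if_true] at h1
    rw [h1, ← sub_zero (∑ i ∈ Finset.range (n + 1), _ * _), h0, ← Finset.sum_sub_distrib]
    exact Finset.sum_congr rfl fun i _ => by ring
  have hterm : ∀ i ∈ Finset.range (n + 1),
      ‖c i * ((u x - u (x + s i • y)) + (u (x + s i • y) -
        ∑ k ∈ Finset.range (n + 1), a k * s i ^ k)) * (-1)‖ₑ ≤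
      ENNReal.ofReal |c i| * (ENNReal.ofReal (K * ‖y‖ ^ α) + ENNReal.ofReal (‖y‖ ^ (n + 1)) *
        ∑ i ∈ Finset.range (n + 1), R i) := by
    intro i hi
    have hci : ‖c i‖ₑ = ENNReal.ofReal |c i| := (ofReal_norm _).symm
    rw [enorm_mul, enorm_mul, hci, enorm_neg, enorm_one, mul_one]
    gcongr
    refine (enorm_add_le _ _).trans (add_le_add ?_ ?_)
    · rw [← ofReal_norm, Real.norm_eq_abs]
      refine ENNReal.ofReal_le_ofReal ((hhol _ _).trans ?_)
      gcongr
      rw [sub_add_cancel_left, norm_neg, norm_smul, Real.norm_eq_abs, abs_of_pos (hs01 i hi).1]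
      exact mul_le_of_le_one_left (norm_nonneg _) (hs01 i hi).2
    · refine (enorm_sub_taylor_le hu x y (hs01 i hi)).trans ?_
      gcongr
      exact Finset.single_le_sum (f := R) (fun _ _ => zero_le) hi
  have hja : iteratedFDeriv ℝ j u x (fun _ => y) = j ! * a j := by
    rw [ha]; field_simp
  rw [hja, enorm_mul, haj, ENNReal.ofReal_mul (by positivity), mul_assoc]
  have hjf : ‖(j ! : ℝ)‖ₑ = ENNReal.ofReal (j !) := by
    rw [← ofReal_norm, Real.norm_natCast]
  rw [hjf]
  gcongr
  refine (enorm_sum_le _ _).trans ((Finset.sum_le_sum hterm).trans ?_)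
  rw [← Finset.sum_mul, ← ENNReal.ofReal_sum_of_nonneg fun _ _ => abs_nonneg _]
  gcongr
  linarith

end Taylor

section Interpolation

open Metric Set
open scoped ENNReal Nat

theorem setLIntegral_ball_comp_add_right_le {E : Type*} [NormedAddCommGroup E] [MeasurableSpace E]
    [BorelSpace E] (μ : Measure E) [μ.IsAddRightInvariant] (G : E → ℝ≥0∞) {w : E} {ρ r : ℝ}
    (hw : ρ + ‖w‖ ≤ r) :
    ∫⁻ y in ball (0 : E) ρ, G (y + w) ∂μ ≤ ∫⁻ y in ball (0 : E) r, G y ∂μ := by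
  rw [← lintegral_indicator measurableSet_ball, ← lintegral_indicator measurableSet_ball,
    ← lintegral_add_right_eq_self ((ball (0 : E) r).indicator G) w]
  refine lintegral_mono fun y => ?_
  by_cases hy : y ∈ ball (0 : E) ρ
  · rw [indicator_of_mem hy, indicator_of_mem]
    rw [mem_ball_zero_iff] at hy ⊢
    exact (norm_add_le _ _).trans_lt (by linarith)
  · rw [indicator_of_notMem hy]
    exact zero_le

variable {E : Type*} [NormedAddCommGroup E] [NormedSpace ℝ E]

theorem ContinuousMultilinearMap.opNorm_mul_pow_le_of_ball {j : ℕ}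
    (T : ContinuousMultilinearMap ℝ (fun _ : Fin j => E) ℝ) {ρ b : ℝ} (hρ : 0 < ρ) (hb : 0 ≤ b)
    (h : ∀ v : Fin j → E, (∀ i, ‖v i‖ ≤ ρ) → ‖T v‖ ≤ b) : ‖T‖ * ρ ^ j ≤ b := by
  rw [← le_div_iff₀ (by positivity)]
  refine T.opNorm_le_bound (by positivity) fun v => ?_
  by_cases hv : ∃ i, v i = 0
  · obtain ⟨i, hi⟩ := hv
    rw [T.map_coord_zero i hi, norm_zero]
    positivity
  · push Not at hv
    have h1 := h (fun i => (ρ / ‖v i‖) • v i) fun i => by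
      rw [norm_smul, norm_div, norm_norm, Real.norm_of_nonneg hρ.le,
        div_mul_cancel₀ _ (norm_ne_zero_iff.2 (hv i))]
    rw [T.map_smul_univ, norm_smul, norm_prod] at h1
    have h2 : ∏ i, ‖ρ / ‖v i‖‖ = ρ ^ j / ∏ i, ‖v i‖ := by
      simp [Finset.prod_div_distrib, abs_of_pos hρ]
    have h3 : 0 < ∏ i, ‖v i‖ := Finset.prod_pos fun i _ => norm_pos_iff.2 (hv i)
    rw [h2, div_mul_eq_mul_div, div_le_iff₀ h3] at h1
    rw [div_mul_eq_mul_div, le_div_iff₀ (by positivity)]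
    linarith

variable [FiniteDimensional ℝ E] [MeasurableSpace E] [BorelSpace E] (μ : Measure E)
  [μ.IsAddHaarMeasure]

/-- The norm of a symmetric multilinear map is controlled by the averages of its diagonal
values. -/
theorem ContinuousMultilinearMap.enorm_mul_measure_ball_le {j : ℕ}
    (T : ContinuousMultilinearMap ℝ (fun _ : Fin j => E) ℝ)
    (hT : ∀ (v : Fin j → E) (σ : Equiv.Perm (Fin j)), T (v ∘ σ) = T v) {r : ℝ} (hr : 0 < r) :
    ‖T‖ₑ * ENNReal.ofReal (r ^ j) * μ (ball 0 r) ≤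
      ENNReal.ofReal ((j + 1) ^ j * (j + 1) ^ Module.finrank ℝ E * 2 ^ j) *
        ∫⁻ y in ball (0 : E) r, ‖T (fun _ => y)‖ₑ ∂μ := by
  set I := ∫⁻ y in ball (0 : E) r, ‖T (fun _ => y)‖ₑ ∂μ with hI
  have hj1 : (0 : ℝ) < j + 1 := by positivity
  set ρ := r / (j + 1) with hρ
  have hρ0 : 0 < ρ := by positivity
  have hrρ : r = (j + 1) * ρ := by rw [hρ]; field_simp
  have hμ : μ (ball 0 r) = ENNReal.ofReal ((j + 1) ^ Module.finrank ℝ E) * μ (ball 0 ρ) := by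
    rw [hrρ, Measure.addHaar_ball_mul_of_pos μ 0 hj1]
  have hμ0 : μ (ball 0 r) ≠ 0 := (measure_ball_pos μ 0 hr).ne'
  have hcont : Continuous fun y : E => T (fun _ => y) := by fun_prop
  have key : ∀ v : Fin j → E, (∀ i, ‖v i‖ ≤ ρ) →
      ‖T v‖ₑ * μ (ball 0 ρ) ≤ ENNReal.ofReal (2 ^ j) * I := by
    intro v hv
    have hpt : ∀ y, ‖T v‖ₑ ≤ ∑ S : Finset (Fin j), ‖T (fun _ => y + ∑ i ∈ S, v i)‖ₑ := by
      intro y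
      have h1 := T.sum_powerset_neg_one_pow_map_add_sum v y
      simp only [hT, Finset.sum_const, Finset.card_univ, Fintype.card_perm, Fintype.card_fin] at h1
      have h2 : ‖T v‖ₑ ≤ ‖(-1 : ℝ) ^ j • j ! • T v‖ₑ := by
        rw [← ofReal_norm, ← ofReal_norm]
        refine ENNReal.ofReal_le_ofReal ?_
        rw [norm_smul, norm_pow, norm_neg, norm_one, one_pow, one_mul, nsmul_eq_mul, norm_mul,
          Real.norm_natCast]
        exact le_mul_of_one_le_left (norm_nonneg _) (by exact_mod_cast Nat.factorial_pos j)
      refine h2.trans ?_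
      rw [← h1]
      refine (enorm_sum_le _ _).trans (Finset.sum_le_sum fun S _ => ?_)
      rw [enorm_smul, enorm_pow, enorm_neg, enorm_one, one_pow, one_mul]
    calc ‖T v‖ₑ * μ (ball 0 ρ) = ∫⁻ _ in ball (0 : E) ρ, ‖T v‖ₑ ∂μ := by simp
      _ ≤ ∫⁻ y in ball (0 : E) ρ, ∑ S : Finset (Fin j), ‖T (fun _ => y + ∑ i ∈ S, v i)‖ₑ ∂μ :=
          lintegral_mono hpt
      _ = ∑ S : Finset (Fin j), ∫⁻ y in ball (0 : E) ρ, ‖T (fun _ => y + ∑ i ∈ S, v i)‖ₑ ∂μ := by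
          refine lintegral_finsetSum _ fun S _ => ?_
          exact (hcont.comp (continuous_id.add continuous_const)).enorm.measurable
      _ ≤ ∑ _S : Finset (Fin j), I := by
          refine Finset.sum_le_sum fun S _ =>
            setLIntegral_ball_comp_add_right_le μ (fun y => ‖T (fun _ => y)‖ₑ) ?_
          have h3 : ‖∑ i ∈ S, v i‖ ≤ j * ρ := by
            refine (norm_sum_le_of_le S fun i _ => hv i).trans ?_
            rw [Finset.sum_const, nsmul_eq_mul]
            gcongr
            simpa using S.card_le_univ
          linarith
      _ = _ := by
          rw [Finset.sum_const, Finset.card_univ, Fintype.card_finset, Fintype.card_fin,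
            nsmul_eq_mul, ENNReal.ofReal_pow two_pos.le]
          simp
  by_cases hItop : I = ∞
  · rw [hItop, ENNReal.mul_top (by simp; positivity)]
    exact le_top
  have hμρ0 : μ (ball 0 ρ) ≠ 0 := (measure_ball_pos μ 0 hρ0).ne'
  have hμρ : μ (ball 0 ρ) ≠ ∞ := measure_ball_lt_top.ne
  have hne : ENNReal.ofReal (2 ^ j) * I / μ (ball 0 ρ) ≠ ∞ :=
    ENNReal.div_ne_top (ENNReal.mul_ne_top ENNReal.ofReal_ne_top hItop) hμρ0
  have hop := T.opNorm_mul_pow_le_of_ball hρ0 ENNReal.toReal_nonneg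
    (b := (ENNReal.ofReal (2 ^ j) * I / μ (ball 0 ρ)).toReal) fun v hv => by
      rw [← toReal_enorm]
      refine ENNReal.toReal_mono hne ?_
      rw [ENNReal.le_div_iff_mul_le (Or.inl hμρ0) (Or.inl hμρ)]
      exact key v hv
  have hop' := ENNReal.ofReal_le_ofReal hop
  rw [ENNReal.ofReal_toReal hne, ENNReal.le_div_iff_mul_le (Or.inl hμρ0) (Or.inl hμρ),
    ENNReal.ofReal_mul (norm_nonneg _), ofReal_norm] at hop'
  have hrj : ENNReal.ofReal (r ^ j) = ENNReal.ofReal ((j + 1) ^ j) * ENNReal.ofReal (ρ ^ j) := by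
    rw [hrρ, mul_pow, ENNReal.ofReal_mul (by positivity)]
  rw [hrj, hμ, ENNReal.ofReal_mul (by positivity), ENNReal.ofReal_mul (by positivity)]
  calc _ = ENNReal.ofReal ((j + 1) ^ j) * ENNReal.ofReal ((j + 1) ^ Module.finrank ℝ E) *
        (‖T‖ₑ * ENNReal.ofReal (ρ ^ j) * μ (ball 0 ρ)) := by ring
    _ ≤ _ := by
      rw [mul_assoc _ (ENNReal.ofReal (2 ^ j))]
      gcongr

theorem exists_setLIntegral_iteratedFDeriv_diag_le {n j : ℕ} (hj : 0 < j) (hjn : j < n + 1)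
    {α : ℝ} (hα : 0 ≤ α) :
    ∃ C : ℝ, 0 < C ∧ ∀ {u : E → ℝ} {K : ℝ}, 0 ≤ K → ContDiff ℝ (n + 1 : ℕ) u →
      (∀ x y, |u x - u y| ≤ K * ‖x - y‖ ^ α) → ∀ x {r : ℝ}, 0 < r →
      ∫⁻ y in ball (0 : E) r, ‖iteratedFDeriv ℝ j u x (fun _ => y)‖ₑ ∂μ ≤
        ENNReal.ofReal C * (ENNReal.ofReal (K * r ^ α) + ENNReal.ofReal (r ^ (n + 1)) *
          maximalFunction μ (fun z => ‖iteratedFDeriv ℝ (n + 1) u z‖ₑ) x) * μ (ball 0 r) := by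
  set s : ℕ → ℝ := fun i => (i + 1) / (n + 1) with hs
  have hn : (0 : ℝ) < n + 1 := by positivity
  have hs01 : ∀ i ∈ Finset.range (n + 1), s i ∈ Ioc 0 1 := fun i hi =>
    ⟨by positivity, (div_le_one hn).2 (by
      have : i ≤ n := Nat.lt_succ_iff.1 (Finset.mem_range.1 hi)
      exact_mod_cast Nat.succ_le_succ this)⟩
  have hinj : Set.InjOn s (Finset.range (n + 1)) := fun i _ k _ h => by
    rw [hs] at h
    simpa [div_left_inj' hn.ne'] using h
  obtain ⟨C, hC, hmain⟩ := exists_enorm_iteratedFDeriv_diag_le (E := E) hj hjn hinj hs01 hα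
  refine ⟨C * (n + 1), by positivity, fun {u K} hK hu hhol x r hr => ?_⟩
  set g : E → ℝ≥0∞ := fun z => ‖iteratedFDeriv ℝ (n + 1) u z‖ₑ with hg
  have hgc : Continuous g := (hu.continuous_iteratedFDeriv le_rfl).enorm
  have hgm : Measurable g := hgc.measurable
  have hintegral : ∀ i ∈ Finset.range (n + 1),
      ∫⁻ y in ball (0 : E) r, (∫⁻ t in Ioc (0 : ℝ) 1, g (x + (t * s i) • y)) ∂μ ≤
        μ (ball 0 r) * maximalFunction μ g x := by
    intro i hi
    rw [lintegral_lintegral_swap]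
    · calc _ ≤ ∫⁻ _ in Ioc (0 : ℝ) 1, μ (ball 0 r) * maximalFunction μ g x :=
            setLIntegral_mono' measurableSet_Ioc fun t ht =>
              setLIntegral_ball_comp_add_smul_le μ hgm x (mul_pos ht.1 (hs01 i hi).1) hr
        _ = _ := by simp
    · exact (hgc.comp (by fun_prop : Continuous fun z : E × ℝ =>
        x + (z.2 * s i) • z.1)).measurable.aemeasurable
  have hmeas : ∀ i, Measurable fun y : E => ∫⁻ t in Ioc (0 : ℝ) 1, g (x + (t * s i) • y) :=
    fun i => Measurable.lintegral_prod_right' (f := fun z : E × ℝ => g (x + (z.2 * s i) • z.1))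
      (hgc.comp (by fun_prop)).measurable
  calc _ ≤ ∫⁻ y in ball (0 : E) r, ENNReal.ofReal C * (ENNReal.ofReal (K * r ^ α) +
        ENNReal.ofReal (r ^ (n + 1)) *
          ∑ i ∈ Finset.range (n + 1), ∫⁻ t in Ioc (0 : ℝ) 1, g (x + (t * s i) • y)) ∂μ := by
        refine setLIntegral_mono' measurableSet_ball fun y hy => (hmain hK hu hhol x y).trans ?_
        have hy' : ‖y‖ ≤ r := (mem_ball_zero_iff.1 hy).le
        gcongr
    _ = ENNReal.ofReal C * (ENNReal.ofReal (K * r ^ α) * μ (ball 0 r) +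
        ENNReal.ofReal (r ^ (n + 1)) * ∑ i ∈ Finset.range (n + 1),
          ∫⁻ y in ball (0 : E) r, (∫⁻ t in Ioc (0 : ℝ) 1, g (x + (t * s i) • y)) ∂μ) := by
        rw [lintegral_const_mul' _ _ ENNReal.ofReal_ne_top, lintegral_add_left measurable_const,
          lintegral_const_mul' _ _ ENNReal.ofReal_ne_top,
          lintegral_finsetSum _ fun i _ => hmeas i]
        simp
    _ ≤ ENNReal.ofReal C * (ENNReal.ofReal (n + 1) * (ENNReal.ofReal (K * r ^ α) * μ (ball 0 r)) +
        ENNReal.ofReal (r ^ (n + 1)) * ∑ i ∈ Finset.range (n + 1),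
          μ (ball 0 r) * maximalFunction μ g x) := by
        have h1 : 1 ≤ ENNReal.ofReal (n + 1) := ENNReal.one_le_ofReal.2 (by simp)
        exact mul_le_mul_right (add_le_add (le_mul_of_one_le_left zero_le h1)
          (mul_le_mul_right (Finset.sum_le_sum hintegral) _)) _
    _ = _ := by
        have hcast : ((n + 1 : ℕ) : ℝ≥0∞) = ENNReal.ofReal (n + 1) := by
          rw [← Nat.cast_succ, ENNReal.ofReal_natCast]
        rw [Finset.sum_const, Finset.card_range, nsmul_eq_mul, hcast,
          ENNReal.ofReal_mul hC.le]
        ring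

/-- Pointwise control of an intermediate derivative at every scale. -/
theorem exists_enorm_iteratedFDeriv_mul_pow_le {n j : ℕ} (hj : 0 < j) (hjn : j < n + 1)
    {α : ℝ} (hα : 0 ≤ α) :
    ∃ C : ℝ, 0 < C ∧ ∀ {u : E → ℝ} {K : ℝ}, 0 ≤ K → ContDiff ℝ (n + 1 : ℕ) u →
      (∀ x y, |u x - u y| ≤ K * ‖x - y‖ ^ α) → ∀ x {r : ℝ}, 0 < r →
      ‖iteratedFDeriv ℝ j u x‖ₑ * ENNReal.ofReal (r ^ j) ≤
        ENNReal.ofReal C * (ENNReal.ofReal (K * r ^ α) + ENNReal.ofReal (r ^ (n + 1)) *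
          maximalFunction μ (fun z => ‖iteratedFDeriv ℝ (n + 1) u z‖ₑ) x) := by
  obtain ⟨C, hC, hmain⟩ := exists_setLIntegral_iteratedFDeriv_diag_le μ hj hjn hα
  refine ⟨(j + 1) ^ j * (j + 1) ^ Module.finrank ℝ E * 2 ^ j * C, by positivity,
    fun {u K} hK hu hhol x r hr => ?_⟩
  have hsymm := (iteratedFDeriv ℝ j u x).enorm_mul_measure_ball_le μ
    (fun v σ => (hu.of_le (by exact_mod_cast hjn.le)).iteratedFDeriv_comp_perm_real x v σ) hr
  have h := hsymm.trans (mul_le_mul_right (hmain hK hu hhol x hr) _)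
  rw [← mul_assoc, ← mul_assoc, ← ENNReal.ofReal_mul (by positivity)] at h
  exact (ENNReal.mul_le_mul_iff_left (measure_ball_pos μ (0 : E) hr).ne'
    measure_ball_lt_top.ne).1 h

open Topology Filter in
/-- Optimization over the scale. -/
theorem ENNReal.le_rpow_mul_rpow_of_forall_scale {a N : ℝ≥0∞} {C K α : ℝ} {j m : ℕ} (hC : 0 < C)
    (hK : 0 < K) (hαj : α < j) (hjm : j < m)
    (h : ∀ r : ℝ, 0 < r → a * ENNReal.ofReal (r ^ j) ≤
      ENNReal.ofReal C * (ENNReal.ofReal (K * r ^ α) + ENNReal.ofReal (r ^ m) * N)) :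
    a ≤ ENNReal.ofReal (2 * C) * ENNReal.ofReal (K ^ (1 - (j - α) / (m - α))) *
      N ^ ((j - α) / (m - α)) := by
  have hjm' : (j : ℝ) < m := by exact_mod_cast hjm
  have hmα : 0 < m - α := by linarith
  set θ := (j - α) / (m - α) with hθ
  have hθ0 : 0 < θ := div_pos (by linarith) hmα
  by_cases hN : N = ∞
  · rw [hN, ENNReal.top_rpow_of_pos hθ0, ENNReal.mul_top]
    · exact le_top
    · have : 0 < K ^ (1 - θ) := by positivity
      simp [hC, this]
  lift N to NNReal using hN
  have key : ∀ N' : ℝ, N < N' → a ≤ ENNReal.ofReal (2 * C * K ^ (1 - θ) * N' ^ θ) := by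
    intro N' hN'
    have hN0 : 0 < N' := N.coe_nonneg.trans_lt hN'
    set r := (K / N') ^ (m - α)⁻¹ with hr
    have hr0 : 0 < r := by positivity
    have hrm : r ^ m * N' = K * r ^ α := by
      have h1 : r ^ (m - α) = K / N' := by
        rw [hr, ← Real.rpow_mul (by positivity), inv_mul_cancel₀ hmα.ne', Real.rpow_one]
      rw [Real.rpow_sub hr0, Real.rpow_natCast, div_eq_div_iff (by positivity) hN0.ne'] at h1
      exact h1
    have hrj : K * r ^ α = K ^ (1 - θ) * N' ^ θ * r ^ j := by
      have h1 : r ^ (j - α) = (K / N') ^ θ := by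
        rw [hr, ← Real.rpow_mul (by positivity), hθ, inv_mul_eq_div]
      rw [Real.rpow_sub hr0, Real.rpow_natCast, Real.div_rpow hK.le hN0.le,
        div_eq_div_iff (by positivity) (by positivity)] at h1
      rw [Real.rpow_sub hK, Real.rpow_one, div_mul_eq_mul_div, div_mul_eq_mul_div,
        _root_.eq_div_iff (Real.rpow_pos_of_pos hK θ).ne']
      linear_combination -K * h1
    have h2 : a * ENNReal.ofReal (r ^ j) ≤
        ENNReal.ofReal (2 * C * K ^ (1 - θ) * N' ^ θ) * ENNReal.ofReal (r ^ j) := by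
      calc _ ≤ ENNReal.ofReal C * (ENNReal.ofReal (K * r ^ α) + ENNReal.ofReal (r ^ m) *
            ENNReal.ofReal N') := by
            refine (h r hr0).trans ?_
            gcongr
            rw [← ENNReal.ofReal_coe_nnreal]
            exact ENNReal.ofReal_le_ofReal hN'.le
        _ = _ := by
            rw [← ENNReal.ofReal_mul (by positivity), ← ENNReal.ofReal_add (by positivity)
              (by positivity), ← ENNReal.ofReal_mul hC.le, ← ENNReal.ofReal_mul (by positivity),
              hrm, hrj]
            congr 1; ring
    exact (ENNReal.mul_le_mul_iff_left (by simp; positivity) ENNReal.ofReal_ne_top).1 h2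
  have hlim : Tendsto (fun N' : ℝ => ENNReal.ofReal (2 * C * K ^ (1 - θ) * N' ^ θ))
      (𝓝[>] (N : ℝ)) (𝓝 (ENNReal.ofReal (2 * C * K ^ (1 - θ) * (N : ℝ) ^ θ))) :=
    ((ENNReal.continuous_ofReal.comp (continuous_const.mul
      (Real.continuous_rpow_const hθ0.le))).tendsto _).mono_left nhdsWithin_le_nhds
  refine (ge_of_tendsto hlim (eventually_mem_nhdsWithin.mono fun N' hN' => key N' hN')).trans_eq ?_
  rw [ENNReal.ofReal_mul (by positivity), ENNReal.ofReal_mul (by positivity),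
    ← ENNReal.ofReal_rpow_of_nonneg N.coe_nonneg hθ0.le, ENNReal.ofReal_coe_nnreal]

/-- Pointwise interpolation between a Hölder bound and the maximal function of the highest
derivative. -/
theorem exists_enorm_iteratedFDeriv_le_maximalFunction_rpow {m j : ℕ} (hj : 0 < j) (hjm : j < m)
    {α : ℝ} (hα : 0 ≤ α) (hαj : α < j) :
    ∃ C : ℝ, 0 < C ∧ ∀ {u : E → ℝ} {K : ℝ}, 0 ≤ K → ContDiff ℝ m u →
      (∀ x y, |u x - u y| ≤ K * ‖x - y‖ ^ α) → ∀ x,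
      ‖iteratedFDeriv ℝ j u x‖ₑ ≤ ENNReal.ofReal C *
        ENNReal.ofReal (K ^ (1 - (j - α) / (m - α))) *
          maximalFunction μ (fun z => ‖iteratedFDeriv ℝ m u z‖ₑ) x ^ ((j - α) / (m - α)) := by
  obtain ⟨n, rfl⟩ : ∃ n, m = n + 1 := ⟨m - 1, by omega⟩
  obtain ⟨C, hC, hmain⟩ := exists_enorm_iteratedFDeriv_mul_pow_le μ hj hjm hα
  refine ⟨2 * C, by positivity, fun {u K} hK hu hhol x => ?_⟩
  rcases hK.eq_or_lt with rfl | hK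
  · have hconst : u = fun _ => u x := funext fun y => by
      have := hhol y x
      rw [zero_mul] at this
      exact sub_eq_zero.1 (abs_nonpos_iff.1 this)
    have h0 : ‖iteratedFDeriv ℝ j u x‖ₑ = 0 := by
      rw [← ofReal_norm, hconst, iteratedFDeriv_const_of_ne hj.ne', Pi.zero_apply, norm_zero,
        ENNReal.ofReal_zero]
    rw [h0]
    exact zero_le
  · exact ENNReal.le_rpow_mul_rpow_of_forall_scale hC hK hαj hjm
      fun r hr => hmain hK.le hu hhol x hr

end Interpolation

/-- Nirenberg's interpolation inequality with Hölder norms: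
`‖∇^j u‖_{L^q} ≤ C ‖∇^m u‖_{L^p}^θ [u]_{C^α}^{1-θ}` with
`α = (jq - mp)/(q-p)`, `θ = p/q`, for `pm/j < q ≤ p(m-1)/(j-1)`. -/
theorem stmt_8 (d j m : ℕ) (hd : 2 ≤ d) (hj : 0 < j) (hjm : j < m)
    (p q : ℝ) (hp : 1 < p) (hpq : p < q)
    (hq1 : p * m / j < q) (hq2 : ((j : ℝ) - 1) * q ≤ p * ((m : ℝ) - 1))
    (α θ : ℝ) (hα : α = ((j : ℝ) * q - m * p) / (q - p)) (hθ : θ = p / q) :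
    ∃ C > (0:ℝ), ∀ (u : EuclideanSpace ℝ (Fin d) → ℝ) (K : ℝ), 0 ≤ K →
      ContDiff ℝ (m : ℕ∞) u →
      (∀ x y, |u x - u y| ≤ K * ‖x - y‖ ^ α) →
      eLpNorm (fun x => ‖iteratedFDeriv ℝ j u x‖) (ENNReal.ofReal q) volume ≤
        ENNReal.ofReal C *
          (eLpNorm (fun x => ‖iteratedFDeriv ℝ m u x‖) (ENNReal.ofReal p) volume) ^ θ *
          ENNReal.ofReal (K ^ (1 - θ)) := by
  have hqp : 0 < q - p := sub_pos.2 hpq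
  have hp0 : 0 < p := zero_lt_one.trans hp
  have hq0 : 0 < q := hp0.trans hpq
  have hj0 : (0 : ℝ) < j := by exact_mod_cast hj
  have hjm' : (0 : ℝ) < m - j := sub_pos.2 (by exact_mod_cast hjm)
  have hα0 : 0 ≤ α := by
    rw [hα]
    rw [div_lt_iff₀ hj0] at hq1
    exact div_nonneg (by linarith) hqp.le
  have h1 : j - α = p * (m - j) / (q - p) := by rw [hα]; field_simp; ring
  have h2 : m - α = q * (m - j) / (q - p) := by rw [hα]; field_simp; ring
  have hαj : α < j := by
    rw [← sub_pos, h1]; positivity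
  have hexp : (j - α) / (m - α) = θ := by
    rw [h1, h2, hθ]; field_simp
  obtain ⟨C, hC, hmain⟩ := exists_enorm_iteratedFDeriv_le_maximalFunction_rpow
    (volume : Measure (EuclideanSpace ℝ (Fin d))) hj hjm hα0 hαj
  rw [hexp] at hmain
  set A := p * (2 * 5 ^ Module.finrank ℝ (EuclideanSpace ℝ (Fin d))) * (p - 1)⁻¹ * 2 ^ (p - 1)
    with hA
  have hA0 : 0 < A := by
    have : 0 < p - 1 := sub_pos.2 hp
    positivity
  refine ⟨C * A ^ (1 / q), by positivity, fun u K hK hu hhol => ?_⟩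
  have hu' : ContDiff ℝ m u := hu
  have hgm : Measurable fun z => ‖iteratedFDeriv ℝ m u z‖ₑ :=
    (hu'.continuous_iteratedFDeriv le_rfl).enorm.measurable
  have hmax := lintegral_maximalFunction_rpow_le volume hgm hp
  rw [eLpNorm_norm, eLpNorm_norm,
    eLpNorm_eq_lintegral_rpow_enorm_toReal (by simpa) ENNReal.ofReal_ne_top,
    eLpNorm_eq_lintegral_rpow_enorm_toReal (by simpa) ENNReal.ofReal_ne_top,
    ENNReal.toReal_ofReal hq0.le, ENNReal.toReal_ofReal hp0.le, ← ENNReal.rpow_mul]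
  have hpθ : 1 / p * θ = 1 / q := by rw [hθ]; field_simp
  have hθq : θ * q = p := by rw [hθ]; field_simp
  rw [hpθ]
  have hq1' : 0 ≤ 1 / q := by positivity
  have hqq : q * (1 / q) = 1 := by field_simp
  set c := ENNReal.ofReal C * ENNReal.ofReal (K ^ (1 - θ)) with hc
  have hctop : c ^ q ≠ ⊤ := by finiteness
  calc _ ≤ (∫⁻ x, (c * maximalFunction volume (fun z => ‖iteratedFDeriv ℝ m u z‖ₑ) x ^ θ) ^ q) ^
        (1 / q) := by
        gcongr with x
        exact hmain hK hu' hhol x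
    _ = (c ^ q * ∫⁻ x, maximalFunction volume (fun z => ‖iteratedFDeriv ℝ m u z‖ₑ) x ^ p) ^
        (1 / q) := by
        rw [← lintegral_const_mul' _ _ hctop]
        simp_rw [ENNReal.mul_rpow_of_nonneg _ _ hq0.le, ← ENNReal.rpow_mul, hθq]
    _ ≤ (c ^ q * (ENNReal.ofReal A * ∫⁻ x, ‖iteratedFDeriv ℝ m u x‖ₑ ^ p)) ^ (1 / q) := by
        gcongr
    _ = _ := by
        rw [ENNReal.mul_rpow_of_nonneg _ _ hq1', ENNReal.mul_rpow_of_nonneg _ _ hq1',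
          ← ENNReal.rpow_mul, hqq, ENNReal.rpow_one, ENNReal.ofReal_rpow_of_pos hA0,
          ENNReal.ofReal_mul hC.le, hc]
        ring
end
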